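/- arXiv:2103.01339 — 12 statements merged into one kernel-verified Lean document; each statement's English description precedes it below -/
import Mathlib

section
/- Let X be a set, let (x_α)_{α∈A} and (y_β)_{β∈B} be nets in X, and suppose (y_β) is a quasi-subnet of (x_α), i.e. for every α₀ ∈ A there exists β₀ ∈ B with {y_β : β ≥ β₀} ⊆ {x_α : α ≥ α₀}. Then there exist a nonempty directed preordered set C and a monotone map φ : C → A whose range is cofinal in A (for every α₀ ∈ A there is c₀ ∈ C with φ(c) ≥ α₀ whenever c ≥ c₀) such that the subnet x∘φ is tail equivalent to (y_β): each of x∘φ and (y_β) is a quasi-subnet of the other (equivalently, their tail filters coincide). -/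
open Filter Set

universe u v w

/-- If `(y_β)` is a quasi-subnet of `(x_α)` (every tail of `x`
contains a tail of `y`), then there is a nonempty directed preordered set `C`
and a monotone map `φ : C → A` with cofinal range such that the subnet `x ∘ φ`
is tail equivalent to `(y_β)`, i.e. their tail filters coincide. -/
theorem quasiSubnet_tailEquiv_subnet {X : Type u} {A : Type v} {B : Type w}
    [Preorder A] [Nonempty A] [IsDirected A (· ≤ ·)]
    [Preorder B] [Nonempty B] [IsDirected B (· ≤ ·)]
    (x : A → X) (y : B → X)
    (h : ∀ α₀ : A, ∃ β₀ : B, y '' Set.Ici β₀ ⊆ x '' Set.Ici α₀) :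
    ∃ (C : Type (max v w)) (pC : Preorder C), Nonempty C ∧ IsDirected C pC.le ∧
      ∃ φ : C → A,
        (∀ c₁ c₂ : C, pC.le c₁ c₂ → φ c₁ ≤ φ c₂) ∧
        (∀ α₀ : A, ∃ c₀ : C, ∀ c : C, pC.le c₀ c → α₀ ≤ φ c) ∧
        Filter.map (x ∘ φ) (@Filter.atTop C pC) = Filter.map y Filter.atTop := by
  have key : ∀ (a : A) (b : B), ∃ b₀ : B, b ≤ b₀ ∧ ∀ b', b₀ ≤ b' →
      ∃ a', a ≤ a' ∧ x a' = y b' := by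
    intro a b
    obtain ⟨β, hβ⟩ := h a
    obtain ⟨b₀, hb, hβb⟩ := exists_ge_ge b β
    refine ⟨b₀, hb, fun b' hb' => ?_⟩
    obtain ⟨a', ha', hx⟩ := hβ ⟨b', hβb.trans hb', rfl⟩
    exact ⟨a', ha', hx⟩
  let C := {p : A × B // x p.1 = y p.2}
  have exists_ge : ∀ (a : A) (b : B), ∃ c : C, a ≤ c.1.1 ∧ b ≤ c.1.2 := by
    intro a b
    obtain ⟨b₀, hb, hb₀⟩ := key a b
    obtain ⟨a', ha, hx⟩ := hb₀ b₀ le_rfl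
    exact ⟨⟨(a', b₀), hx⟩, ha, hb⟩
  have hne : Nonempty C := by
    obtain ⟨c, -⟩ := exists_ge (Classical.arbitrary A) (Classical.arbitrary B)
    exact ⟨c⟩
  have hdir : IsDirected C (· ≤ ·) := by
    refine ⟨fun c₁ c₂ => ?_⟩
    obtain ⟨a, ha₁, ha₂⟩ := exists_ge_ge c₁.1.1 c₂.1.1
    obtain ⟨b, hb₁, hb₂⟩ := exists_ge_ge c₁.1.2 c₂.1.2
    obtain ⟨c, hac, hbc⟩ := exists_ge a b
    exact ⟨c, ⟨ha₁.trans hac, hb₁.trans hbc⟩, ⟨ha₂.trans hac, hb₂.trans hbc⟩⟩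
  refine ⟨C, inferInstance, hne, hdir, fun c => c.1.1, fun _ _ hc => hc.1, fun a => ?_, ?_⟩
  · obtain ⟨c₀, ha, -⟩ := exists_ge a (Classical.arbitrary B)
    exact ⟨c₀, fun c hc => ha.trans hc.1⟩
  · ext s
    simp only [mem_map, mem_atTop_sets, mem_preimage, Function.comp_apply]
    constructor
    · rintro ⟨c₀, hc₀⟩
      obtain ⟨b₀, hb, hb₀⟩ := key c₀.1.1 c₀.1.2
      refine ⟨b₀, fun b' hb' => ?_⟩
      obtain ⟨a', ha', hx⟩ := hb₀ b' hb'
      exact hx ▸ hc₀ ⟨(a', b'), hx⟩ ⟨ha', hb.trans hb'⟩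
    · rintro ⟨b, hb⟩
      obtain ⟨c₀, -, hbc⟩ := exists_ge (Classical.arbitrary A) b
      refine ⟨c₀, fun c hc => ?_⟩
      rw [c.2]
      exact hb _ (hbc.trans hc.2)
end

section
/- Let X be a set, J a nonempty index set, and for each j ∈ J let S_j : A_j → X be a net on a nonempty directed preordered set A_j. Let Γ = (∏_{j∈J} A_j) × J be preordered by (ᾱ, j) ≤ (β̄, k) iff ᾱ(j') ≤ β̄(j') for all j' ∈ J, and define the mixing M : Γ → X by M(ᾱ, j) = S_j(ᾱ(j)). Then Γ is a nonempty directed preordered set, and the tail filter of M equals the set-theoretic intersection of the tail filters of the nets S_j: a set belongs to the tail filter of M if and only if it belongs to the tail filter of S_j for every j ∈ J (in filter-lattice terms, Filter.map M atTop = ⨆_{j∈J} Filter.map S_j atTop). -/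
open Filter Set

universe u v w

/-- The mixing of a family of nets `S j : A j → X` (`j ∈ J`,
`J` nonempty) is the net on `Γ = (∏ j, A j) × J`, preordered by the first
component (pointwise), sending `(ᾱ, j)` to `S j (ᾱ j)`.  Then `Γ` is a
nonempty directed preordered set and the tail filter of the mixing is the
set-theoretic intersection of the tail filters of the `S j`, i.e. their
supremum in the filter lattice. -/
theorem mixing_tailFilter_eq_iSup {X : Type u} {J : Type v} [Nonempty J]
    {A : J → Type w}
    [∀ j, Preorder (A j)] [∀ j, Nonempty (A j)] [∀ j, IsDirected (A j) (· ≤ ·)]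
    (S : ∀ j, A j → X) :
    Nonempty ((∀ j, A j) × J) ∧
    (∀ g₁ g₂ : (∀ j, A j) × J,
      ∃ g₃ : (∀ j, A j) × J, (∀ j, g₁.1 j ≤ g₃.1 j) ∧ (∀ j, g₂.1 j ≤ g₃.1 j)) ∧
    Filter.map (fun p : (∀ j, A j) × J => S p.2 (p.1 p.2))
        (@Filter.atTop _ (Preorder.lift (Prod.fst : ((∀ j, A j) × J) → ∀ j, A j)))
      = ⨆ j : J, Filter.map (S j) Filter.atTop := by
  classical
  have hdir : ∀ g₁ g₂ : (∀ j, A j) × J,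
      ∃ g₃ : (∀ j, A j) × J, (∀ j, g₁.1 j ≤ g₃.1 j) ∧ (∀ j, g₂.1 j ≤ g₃.1 j) := by
    intro g₁ g₂
    choose c hc₁ hc₂ using fun j => exists_ge_ge (g₁.1 j) (g₂.1 j)
    exact ⟨(c, g₁.2), hc₁, hc₂⟩
  refine ⟨inferInstance, hdir, ?_⟩
  ext s
  let P : Preorder ((∀ j, A j) × J) := Preorder.lift Prod.fst
  have hP : @IsDirectedOrder ((∀ j, A j) × J) P.toLE :=
    @IsDirected.mk _ (fun a b => P.le a b) hdir
  rw [Filter.mem_map, @mem_atTop_sets _ P hP inferInstance]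
  simp only [mem_iSup, Filter.mem_map, mem_atTop_sets, mem_preimage]
  constructor
  · rintro ⟨⟨a, _⟩, ha⟩ j
    refine ⟨a j, fun b hb => ?_⟩
    have hle : a ≤ Function.update a j b := le_update_self_iff.2 hb
    simpa using ha (Function.update a j b, j) hle
  · intro h
    choose a ha using h
    exact ⟨(a, Classical.arbitrary J), fun g hg => ha g.2 (g.1 g.2) (hg g.2)⟩
end

section
/- Let X be a set, Λ a nonempty directed preordered set, x : Λ → X a net, and G a countably generated filter on X such that the tail filter of x is finer than G (every member of G contains a tail set of x). Then there exists a monotone increasing sequence (α_n)_{n∈ℕ} in Λ such that the tail filter of the sequence (x_{α_n})_{n∈ℕ} is finer than G; moreover, for every sequence (β_n) in Λ with β_n ≥ α_n for all n, the tail filter of (x_{β_n})_{n∈ℕ} is finer than G. -/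
open Filter Set

universe u v

/-- If the tail filter of a net `x : Λ → X` is finer than a
countably generated filter `G`, then there is a monotone increasing sequence
of indices `(α n)` such that the tail filter of the sequence `(x (α n))` is
finer than `G`; moreover any sequence `(β n)` with `β n ≥ α n` for all `n` has
the same property. -/
theorem exists_monotone_seq_of_countably_generated {X : Type u}
    {Λ : Type v} [Preorder Λ] [Nonempty Λ] [IsDirected Λ (· ≤ ·)]
    (x : Λ → X) (G : Filter X) [G.IsCountablyGenerated]
    (h : Filter.map x Filter.atTop ≤ G) :
    ∃ a : ℕ → Λ, Monotone a ∧
      Filter.map (fun n => x (a n)) Filter.atTop ≤ G ∧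
      ∀ b : ℕ → Λ, (∀ n, a n ≤ b n) →
        Filter.map (fun n => x (b n)) Filter.atTop ≤ G := by
  obtain ⟨s, hs⟩ := G.exists_antitone_basis
  have tail (n : ℕ) : ∃ c, ∀ l, c ≤ l → x l ∈ s n :=
    mem_atTop_sets.1 (h (hs.mem n))
  choose c hc using tail
  choose ub le_ub_left le_ub_right using fun i j : Λ => exists_ge_ge i j
  let a : ℕ → Λ := fun n => Nat.rec (c 0) (fun k y => ub y (c (k + 1))) n
  have ha : Monotone a := monotone_nat_of_le_succ fun n => le_ub_left _ _
  have hca : ∀ n, c n ≤ a n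
    | 0 => le_rfl
    | _ + 1 => le_ub_right _ _
  have key (b : ℕ → Λ) (hb : ∀ n, a n ≤ b n) : map (fun n => x (b n)) atTop ≤ G :=
    hs.tendsto fun n => hc n _ ((hca n).trans (hb n))
  exact ⟨a, ha, key a fun _ => le_rfl, key⟩
end

section
/- Let X be a Riesz space (vector lattice) over ℝ. Then X is Archimedean if and only if scalar multiplication is jointly order continuous: for every net (r_α)_{α∈A} in ℝ converging to r ∈ ℝ and every net (x_β)_{β∈B} in X order converging to x ∈ X, the net (r_α • x_β) indexed by A × B with the componentwise preorder order converges to r • x. (Equivalently, since addition is always jointly order continuous, X is Archimedean iff its order convergence structure is linear.) -/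
open Filter Set Topology

universe u v w

/-- Order convergence of a net `x : A → X` to `l` in a vector lattice: there
is a net `d : Γ → X` (on a nonempty directed preordered set), decreasing with
infimum `0`, such that each `d γ` eventually dominates `|x α - l|`. -/
def OrderConv {X : Type u} {A : Type v} [Lattice X] [AddCommGroup X] [Preorder A]
    (x : A → X) (l : X) : Prop :=
  ∃ (Γ : Type u) (pΓ : Preorder Γ), Nonempty Γ ∧ IsDirected Γ pΓ.le ∧
    ∃ d : Γ → X,
      (∀ γ₁ γ₂ : Γ, pΓ.le γ₁ γ₂ → d γ₂ ≤ d γ₁) ∧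
      IsGLB (Set.range d) 0 ∧
      ∀ γ : Γ, ∃ α₀ : A, ∀ α : A, α₀ ≤ α → |x α - l| ≤ d γ

lemma abs_smul_le_abs_smul_abs {X : Type*} [Lattice X] [AddCommGroup X] [IsOrderedAddMonoid X]
    [Module ℝ X] [PosSMulMono ℝ X] (a : ℝ) (b : X) : |a • b| ≤ |a| • |b| := by
  have key : ∀ c : X, a • c ≤ |a| • |c| := by
    intro c
    rcases le_total 0 a with ha | ha
    · rw [abs_of_nonneg ha]
      exact smul_le_smul_of_nonneg_left (le_abs_self c) ha
    · rw [abs_of_nonpos ha, ← neg_smul_neg]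
      exact smul_le_smul_of_nonneg_left (neg_le_abs c) (neg_nonneg.2 ha)
  refine abs_le'.2 ⟨key b, ?_⟩
  rw [← smul_neg, ← abs_neg b]
  exact key (-b)

/-- In an Archimedean vector lattice, if `d` has infimum `0`, then so does the family
`M • d γ + (n + 1)⁻¹ • u`, for `M > 0` and `u ≥ 0`. -/
lemma isGLB_range_smul_add_inv_smul {X Γ : Type*} [Lattice X] [AddCommGroup X]
    [IsOrderedAddMonoid X] [Module ℝ X] [PosSMulMono ℝ X]
    (hX : ∀ x u : X, (∀ n : ℕ, n • x ≤ u) → x ≤ 0) {d : Γ → X}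
    (hd : IsGLB (Set.range d) 0) {M : ℝ} (hM : 0 < M) {u : X} (hu : 0 ≤ u) :
    IsGLB (Set.range fun p : Γ × ULift ℕ => M • d p.1 + ((p.2.down : ℝ) + 1)⁻¹ • u) 0 := by
  constructor
  · rintro _ ⟨p, rfl⟩
    exact add_nonneg (smul_nonneg hM.le (hd.1 ⟨p.1, rfl⟩)) (smul_nonneg (by positivity) hu)
  · intro b hb
    have hbu : ∀ n : ℕ, b ≤ ((n : ℝ) + 1)⁻¹ • u := by
      intro n
      have h : M⁻¹ • (b - ((n : ℝ) + 1)⁻¹ • u) ≤ 0 := by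
        refine hd.2 ?_
        rintro _ ⟨γ, rfl⟩
        have h1 := sub_le_iff_le_add.2 (hb ⟨(γ, ⟨n⟩), rfl⟩)
        have h2 := smul_le_smul_of_nonneg_left h1 (inv_nonneg.2 hM.le)
        rwa [inv_smul_smul₀ hM.ne'] at h2
      have h3 := smul_le_smul_of_nonneg_left h hM.le
      rw [smul_inv_smul₀ hM.ne', smul_zero] at h3
      exact sub_nonpos.1 h3
    refine hX b u fun n => ?_
    rcases n with _ | n
    · simpa using hu
    · have h := smul_le_smul_of_nonneg_left (hbu n) (by positivity : (0 : ℝ) ≤ (n : ℝ) + 1)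
      rw [smul_inv_smul₀ (by positivity)] at h
      rw [← Nat.cast_smul_eq_nsmul ℝ]
      exact_mod_cast h

lemma orderConv_const {X : Type u} {A : Type v} [Lattice X] [AddCommGroup X]
    [IsOrderedAddMonoid X] [Preorder A] [Nonempty A] (l : X) : OrderConv (fun _ : A => l) l := by
  refine ⟨PUnit, inferInstance, inferInstance, inferInstance, fun _ => 0, fun _ _ _ => le_rfl,
    by simp, fun _ => ⟨Classical.arbitrary A, fun _ _ => by simp⟩⟩

/-- Joint order continuity of scalar multiplication in an Archimedean vector lattice. -/
lemma OrderConv.smul {X : Type u} [Lattice X] [AddCommGroup X] [IsOrderedAddMonoid X]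
    [Module ℝ X] [PosSMulMono ℝ X] (hX : ∀ x u : X, (∀ n : ℕ, n • x ≤ u) → x ≤ 0)
    {A : Type v} [Preorder A] [Nonempty A] [IsDirected A (· ≤ ·)] {B : Type w} [Preorder B]
    {r : A → ℝ} {rl : ℝ} {x : B → X} {xl : X} (hr : Tendsto r atTop (𝓝 rl))
    (hx : OrderConv x xl) : OrderConv (fun p : A × B => r p.1 • x p.2) (rl • xl) := by
  obtain ⟨Γ, pΓ, hne, hdir, d, hanti, hglb, hdom⟩ := hx
  have hM : 0 < |rl| + 1 := by positivity
  refine ⟨Γ × ULift.{u} ℕ, inferInstance, inferInstance, ⟨?_⟩,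
    fun p => (|rl| + 1) • d p.1 + ((p.2.down : ℝ) + 1)⁻¹ • |xl|, ?_,
    isGLB_range_smul_add_inv_smul hX hglb hM (abs_nonneg xl), ?_⟩
  · rintro ⟨γ₁, n₁⟩ ⟨γ₂, n₂⟩
    obtain ⟨γ, h₁, h₂⟩ := hdir.directed γ₁ γ₂
    exact ⟨(γ, n₁ ⊔ n₂), ⟨h₁, le_sup_left⟩, ⟨h₂, le_sup_right⟩⟩
  · rintro ⟨γ₁, n₁⟩ ⟨γ₂, n₂⟩ ⟨hγ, hn⟩
    have hn' : (n₁.down : ℝ) ≤ n₂.down := Nat.cast_le.2 hn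
    refine add_le_add (smul_le_smul_of_nonneg_left (hanti _ _ hγ) hM.le)
      (smul_le_smul_of_nonneg_right ?_ (abs_nonneg xl))
    gcongr
  · rintro ⟨γ, ⟨n⟩⟩
    obtain ⟨β₀, hβ₀⟩ := hdom γ
    have hev : ∀ᶠ α in atTop, |r α| < |rl| + 1 ∧ |r α - rl| < ((n : ℝ) + 1)⁻¹ := by
      refine (hr.abs.eventually_lt_const (lt_add_one _)).and ?_
      have h := Metric.tendsto_nhds.1 hr ((n : ℝ) + 1)⁻¹ (by positivity)
      simpa only [Real.dist_eq] using h
    obtain ⟨α₀, hα₀⟩ := eventually_atTop.1 hev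
    refine ⟨(α₀, β₀), ?_⟩
    rintro ⟨α, β⟩ ⟨hα, hβ⟩
    obtain ⟨h₁, h₂⟩ := hα₀ α hα
    calc |r α • x β - rl • xl| = |r α • (x β - xl) + (r α - rl) • xl| := by
          congr 1
          module
      _ ≤ |r α • (x β - xl)| + |(r α - rl) • xl| := abs_add_le _ _
      _ ≤ |r α| • |x β - xl| + |r α - rl| • |xl| :=
          add_le_add (abs_smul_le_abs_smul_abs _ _) (abs_smul_le_abs_smul_abs _ _)
      _ ≤ (|rl| + 1) • d γ + ((n : ℝ) + 1)⁻¹ • |xl| :=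
          add_le_add
            ((smul_le_smul_of_nonneg_right h₁.le (abs_nonneg _)).trans
              (smul_le_smul_of_nonneg_left (hβ₀ β hβ) hM.le))
            (smul_le_smul_of_nonneg_right h₂.le (abs_nonneg _))

/-- A Riesz space over `ℝ` is Archimedean iff scalar
multiplication is jointly order continuous: whenever a net `(r_α)` of reals
converges to `r` and a net `(x_β)` order converges to `x`, the net
`(r_α • x_β)`, indexed by the componentwise-preordered product, order
converges to `r • x`. -/
theorem archimedean_iff_smul_jointly_order_continuous
    {X : Type u} [Lattice X] [AddCommGroup X]
    [CovariantClass X X (· + ·) (· ≤ ·)] [Module ℝ X] [PosSMulMono ℝ X] :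
    (∀ x u : X, (∀ n : ℕ, n • x ≤ u) → x ≤ 0) ↔
      ∀ (A : Type u) [Preorder A] [Nonempty A] [IsDirected A (· ≤ ·)]
        (B : Type u) [Preorder B] [Nonempty B] [IsDirected B (· ≤ ·)]
        (r : A → ℝ) (rl : ℝ) (x : B → X) (xl : X),
        Filter.Tendsto r Filter.atTop (𝓝 rl) → OrderConv x xl →
          OrderConv (fun p : A × B => r p.1 • x p.2) (rl • xl) := by
  have hadd : ∀ a b : X, a ≤ b → ∀ c, c + a ≤ c + b := fun _ _ h c =>
    CovariantClass.elim (μ := fun x y : X => x + y) c h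
  have : IsOrderedAddMonoid X :=
    { add_le_add_left := fun a b h c => by simpa only [add_comm _ c] using hadd a b h c }
  refine ⟨fun hX A _ _ _ B _ _ _ r rl x xl hr hx => hx.smul hX hr, fun H x u hxu => ?_⟩
  have hr : Tendsto (fun a : ULift.{u} ℕ => ((a.down : ℝ) + 1)⁻¹) atTop (𝓝 0) := by
    have h : Tendsto (ULift.down : ULift.{u} ℕ → ℕ) atTop atTop :=
      tendsto_atTop_atTop.2 fun n => ⟨⟨n⟩, fun _ ha => ha⟩
    simpa only [one_div, Function.comp_def] using
      (tendsto_one_div_add_atTop_nhds_zero_nat (𝕜 := ℝ)).comp h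
  obtain ⟨Γ, pΓ, -, -, d, -, hglb, hdom⟩ :=
    H (ULift.{u} ℕ) PUnit _ 0 (fun _ => u) u hr (orderConv_const u)
  refine hglb.2 ?_
  rintro _ ⟨γ, rfl⟩
  obtain ⟨⟨⟨n⟩, b⟩, hn⟩ := hdom γ
  have h₁ := hn _ le_rfl
  rw [zero_smul, sub_zero] at h₁
  refine le_trans ?_ ((le_abs_self _).trans h₁)
  have hpos : (0 : ℝ) < (n : ℝ) + 1 := by positivity
  have h₂ := hxu (n + 1)
  rw [← Nat.cast_smul_eq_nsmul ℝ, Nat.cast_add_one] at h₂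
  have h₃ := smul_le_smul_of_nonneg_left h₂ (inv_nonneg.2 hpos.le)
  rwa [inv_smul_smul₀ hpos.ne'] at h₃
end

section
/- Let X be an Archimedean Riesz space over ℝ and A a nonempty subset of X. Then A is order bounded (there exists u ∈ X with A ⊆ [−u, u]) if and only if A is bounded for the order convergence structure: for every net (r_α)_{α∈Λ} in ℝ converging to 0, the net ((α, a) ↦ r_α • a) indexed by Λ × A, preordered by the first coordinate, order converges to 0 in X. -/
open Filter Set Topology

universe u v

section RieszSpace

variable {X : Type*} [Lattice X] [AddCommGroup X] [Module ℝ X] [PosSMulMono ℝ X]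

theorem le_inv_smul_of_smul_le {r : ℝ} (hr : 0 < r) {x y : X} (h : r • x ≤ y) :
    x ≤ r⁻¹ • y := by
  simpa [smul_smul, hr.ne'] using smul_le_smul_of_nonneg_left h (inv_nonneg.mpr hr.le)

theorem isGLB_range_inv_natCast_smul (hArch : ∀ x u : X, (∀ n : ℕ, n • x ≤ u) → x ≤ 0)
    {u : X} (hu : 0 ≤ u) :
    IsGLB (Set.range fun n : ULift ℕ => ((n.down : ℝ) + 1)⁻¹ • u) 0 := by
  refine ⟨?_, fun w hw => hArch w u fun n => ?_⟩
  · rintro _ ⟨n, rfl⟩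
    exact smul_nonneg (by positivity) hu
  · cases n with
    | zero => simpa using hu
    | succ k =>
      have hk := smul_le_smul_of_nonneg_left (hw ⟨⟨k⟩, rfl⟩) (by positivity : 0 ≤ (k : ℝ) + 1)
      rw [smul_smul, mul_inv_cancel₀ (by positivity), one_smul] at hk
      rw [← Nat.cast_smul_eq_nsmul ℝ]
      push_cast
      exact hk

variable [IsOrderedAddMonoid X]

theorem smul_le_abs_smul_of_mem_Icc {a u : X} (ha : a ∈ Set.Icc (-u) u) (r : ℝ) :
    r • a ≤ |r| • u := by
  rcases le_total 0 r with hr | hr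
  · rw [abs_of_nonneg hr]
    exact smul_le_smul_of_nonneg_left ha.2 hr
  · rw [abs_of_nonpos hr, ← neg_smul_neg r a]
    exact smul_le_smul_of_nonneg_left (neg_le.mp ha.1) (neg_nonneg.mpr hr)

theorem abs_smul_le_abs_smul_of_mem_Icc {a u : X} (ha : a ∈ Set.Icc (-u) u) (r : ℝ) :
    |r • a| ≤ |r| • u := by
  refine abs_le'.mpr ⟨smul_le_abs_smul_of_mem_Icc ha r, ?_⟩
  rw [← neg_smul, ← abs_neg r]
  exact smul_le_abs_smul_of_mem_Icc ha (-r)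

theorem nonneg_of_mem_Icc_neg {a u : X} (ha : a ∈ Set.Icc (-u) u) : 0 ≤ u := by
  have h : 0 ≤ (2 : ℝ) • u := by
    rw [two_smul]
    exact neg_le_iff_add_nonneg.mp (ha.1.trans ha.2)
  simpa [smul_smul] using smul_nonneg (by norm_num : (0 : ℝ) ≤ 2⁻¹) h

end RieszSpace

/-- In an Archimedean Riesz space over `ℝ`, a nonempty set
`A` is order bounded (contained in some interval `[-u, u]`) iff it is bounded
for the order convergence structure: for every net `(r_α)` of reals converging
to `0`, the net `((α, a) ↦ r_α • a)`, indexed by `Λ × A` preordered by the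
first coordinate, order converges to `0`. -/
theorem orderBounded_iff_bounded_for_orderConvergence
    {X : Type u} [Lattice X] [AddCommGroup X]
    [CovariantClass X X (· + ·) (· ≤ ·)] [Module ℝ X] [PosSMulMono ℝ X]
    (hArch : ∀ x u : X, (∀ n : ℕ, n • x ≤ u) → x ≤ 0)
    (A : Set X) (hA : A.Nonempty) :
    (∃ u : X, A ⊆ Set.Icc (-u) u) ↔
      ∀ (Λ : Type u) [Preorder Λ] [Nonempty Λ] [IsDirected Λ (· ≤ ·)]
        (r : Λ → ℝ), Filter.Tendsto r Filter.atTop (𝓝 (0 : ℝ)) →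
        @OrderConv X (Λ × ↥A) _ _ (Preorder.lift (Prod.fst : Λ × ↥A → Λ))
          (fun p => r p.1 • (p.2 : X)) 0 := by
  have : IsOrderedAddMonoid X :=
    { add_le_add_left _ _ h c := by
        rw [add_comm _ c, add_comm _ c]
        exact CovariantClass.elim c h }
  constructor
  · rintro ⟨u, hAu⟩ Λ _ _ _ r hr
    obtain ⟨a₀, ha₀⟩ := hA
    have hu : 0 ≤ u := nonneg_of_mem_Icc_neg (hAu ha₀)
    refine ⟨ULift ℕ, inferInstance, inferInstance, inferInstance,
      fun n => ((n.down : ℝ) + 1)⁻¹ • u, fun m n hmn => ?_,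
      isGLB_range_inv_natCast_smul hArch hu, fun n => ?_⟩
    · have h : (m.down : ℝ) ≤ n.down := by exact_mod_cast hmn
      rw [← sub_nonneg, ← sub_smul]
      exact smul_nonneg (sub_nonneg.mpr (by gcongr)) hu
    · have hn : (0 : ℝ) < ((n.down : ℝ) + 1)⁻¹ := by positivity
      obtain ⟨l, hl⟩ := eventually_atTop.mp (Metric.tendsto_nhds.mp hr _ hn)
      refine ⟨(l, ⟨a₀, ha₀⟩), fun p hp => ?_⟩
      have hlt := hl p.1 hp
      rw [Real.dist_0_eq_abs] at hlt
      rw [sub_zero]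
      refine (abs_smul_le_abs_smul_of_mem_Icc (hAu p.2.2) _).trans ?_
      rw [← sub_nonneg, ← sub_smul]
      exact smul_nonneg (sub_nonneg.mpr hlt.le) hu
  · intro h
    have hr : Tendsto (fun n : ULift.{u} ℕ => 1 / ((n.down : ℝ) + 1)) atTop (𝓝 0) := by
      refine tendsto_one_div_add_atTop_nhds_zero_nat.comp (tendsto_atTop.mpr fun b => ?_)
      filter_upwards [eventually_ge_atTop (ULift.up b)] with n hn
      exact hn
    obtain ⟨Γ, _, ⟨γ⟩, _, d, _, _, hd⟩ := h (ULift ℕ) _ hr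
    obtain ⟨⟨n, a₀⟩, hn⟩ := hd γ
    have hpos : (0 : ℝ) < 1 / ((n.down : ℝ) + 1) := by positivity
    refine ⟨(1 / ((n.down : ℝ) + 1))⁻¹ • d γ, fun a ha => ?_⟩
    have hle := hn (n, ⟨a, ha⟩) (le_refl n)
    rw [sub_zero] at hle
    refine ⟨neg_le.mp (le_inv_smul_of_smul_le hpos ?_),
      le_inv_smul_of_smul_le hpos ((le_abs_self _).trans hle)⟩
    rw [smul_neg]
    exact (neg_le_abs _).trans hle
end

section
/- Let X be an Archimedean Riesz space over ℝ and (x_α)_{α∈Λ} a monotone increasing net in X that is bounded above (there is u ∈ X with x_α ≤ u for all α). Then (x_α) is order Cauchy: the net (x_α − x_β) indexed by Λ × Λ with the componentwise preorder order converges to 0. The analogous statement holds for decreasing nets bounded below. -/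
open Filter Set Topology

universe u v

/-- The gaps `u - x α` between upper bounds of a net and its values have infimum `0` in an
Archimedean vector lattice. -/
theorem isGLB_upperBound_sub_range {X : Type u} {A : Type v} [Lattice X] [AddCommGroup X]
    [IsOrderedAddMonoid X] [Nonempty A]
    (hArch : ∀ x u : X, (∀ n : ℕ, n • x ≤ u) → x ≤ 0)
    (x : A → X) (hb : BddAbove (Set.range x)) :
    IsGLB {z | ∃ u ∈ upperBounds (Set.range x), ∃ a, z = u - x a} 0 := by
  constructor
  · rintro _ ⟨u, hu, a, rfl⟩
    exact sub_nonneg.2 (hu ⟨a, rfl⟩)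
  · intro l hl
    obtain ⟨u, hu⟩ := hb
    have hmem : ∀ n : ℕ, u - n • l ∈ upperBounds (Set.range x) := by
      intro n
      induction n with
      | zero => simpa using hu
      | succ n ih =>
        rintro _ ⟨a, rfl⟩
        have h : l ≤ u - n • l - x a := hl ⟨_, ih, a, rfl⟩
        rw [succ_nsmul, ← sub_sub]
        exact le_sub_comm.1 h
    obtain ⟨a⟩ := ‹Nonempty A›
    exact hArch l (u - x a) fun n => le_sub_comm.1 (hmem n ⟨a, rfl⟩)

/-- In an Archimedean vector lattice, increasing nets that are bounded above are order Cauchy. -/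
theorem Monotone.orderConv_sub {X : Type u} {A : Type v} [Lattice X] [AddCommGroup X]
    [IsOrderedAddMonoid X] [Preorder A] [Nonempty A] [IsDirected A (· ≤ ·)]
    (hArch : ∀ x u : X, (∀ n : ℕ, n • x ≤ u) → x ≤ 0)
    {x : A → X} (hx : Monotone x) (hb : BddAbove (Set.range x)) :
    OrderConv (fun p : A × A => x p.1 - x p.2) 0 := by
  let S : Set X := {z | ∃ u ∈ upperBounds (Set.range x), ∃ a, z = u - x a}
  refine ⟨Sᵒᵈ, inferInstance, ?_, ⟨?_⟩, fun z => (OrderDual.ofDual z).1, fun _ _ h => h, ?_, ?_⟩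
  · obtain ⟨u, hu⟩ := hb
    obtain ⟨a⟩ := ‹Nonempty A›
    exact ⟨OrderDual.toDual ⟨u - x a, u, hu, a, rfl⟩⟩
  · rintro ⟨_, u, hu, a, rfl⟩ ⟨_, v, hv, b, rfl⟩
    obtain ⟨c, hac, hbc⟩ := exists_ge_ge a b
    exact ⟨OrderDual.toDual
      ⟨u ⊓ v - x c, u ⊓ v, fun _ hy => le_inf (hu hy) (hv hy), c, rfl⟩,
      sub_le_sub inf_le_left (hx hac), sub_le_sub inf_le_right (hx hbc)⟩
  · have hrange : Set.range (fun z : Sᵒᵈ => (OrderDual.ofDual z).1) = S := Subtype.range_coe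
    rw [hrange]
    exact isGLB_upperBound_sub_range hArch x hb
  · rintro ⟨_, u, hu, a, rfl⟩
    refine ⟨(a, a), fun p hp => ?_⟩
    rw [sub_zero]
    refine sup_le (sub_le_sub (hu ⟨_, rfl⟩) (hx hp.2)) ?_
    rw [neg_sub]
    exact sub_le_sub (hu ⟨_, rfl⟩) (hx hp.1)

/-- In an Archimedean Riesz space over `ℝ`, every monotone
increasing net bounded above is order Cauchy (the net `(x_α - x_β)` over the
componentwise-preordered square of the index set order converges to `0`), and
likewise every decreasing net bounded below is order Cauchy. -/
theorem monotone_bounded_net_is_orderCauchy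
    {X : Type u} [Lattice X] [AddCommGroup X]
    [CovariantClass X X (· + ·) (· ≤ ·)] [Module ℝ X] [PosSMulMono ℝ X]
    (hArch : ∀ x u : X, (∀ n : ℕ, n • x ≤ u) → x ≤ 0) :
    (∀ (Λ : Type v) [Preorder Λ] [Nonempty Λ] [IsDirected Λ (· ≤ ·)]
      (x : Λ → X), Monotone x → (∃ u : X, ∀ α, x α ≤ u) →
        OrderConv (fun p : Λ × Λ => x p.1 - x p.2) 0) ∧
    (∀ (Λ : Type v) [Preorder Λ] [Nonempty Λ] [IsDirected Λ (· ≤ ·)]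
      (x : Λ → X), Antitone x → (∃ u : X, ∀ α, u ≤ x α) →
        OrderConv (fun p : Λ × Λ => x p.1 - x p.2) 0) := by
  have : IsOrderedAddMonoid X := { add_le_add_left := fun _ _ h c => add_le_add_left h c }
  refine ⟨fun Λ _ _ _ x hx ⟨u, hu⟩ => hx.orderConv_sub hArch ⟨u, Set.forall_mem_range.2 hu⟩,
    fun Λ _ _ _ x hx ⟨u, hu⟩ => ?_⟩
  obtain ⟨Γ, pΓ, hne, hdir, d, hd, hglb, hconv⟩ :=
    hx.neg.orderConv_sub hArch ⟨-u, Set.forall_mem_range.2 fun α => neg_le_neg (hu α)⟩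
  refine ⟨Γ, pΓ, hne, hdir, d, hd, hglb, fun γ => ?_⟩
  obtain ⟨p₀, hp₀⟩ := hconv γ
  refine ⟨p₀, fun p hp => ?_⟩
  have h := hp₀ p hp
  simp only [sub_zero, neg_sub_neg] at h ⊢
  rwa [abs_sub_comm]
end

section
/- An Archimedean Riesz space X over ℝ is Dedekind complete (every nonempty subset of X that is bounded above has a supremum) if and only if every order Cauchy net in X order converges to some element of X. -/
open Filter Set Topology

universe u v

section OrderCauchy

variable {X : Type u} [Lattice X] [AddCommGroup X] [AddLeftMono X]

/-- In a Dedekind complete lattice-ordered group, order Cauchy nets order converge. -/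
theorem OrderConv.exists_of_cauchy
    (hX : ∀ S : Set X, S.Nonempty → BddAbove S → ∃ s : X, IsLUB S s)
    {A : Type v} [Preorder A] [IsDirected A (· ≤ ·)] {x : A → X}
    (hx : OrderConv (fun p : A × A => x p.1 - x p.2) 0) : ∃ l : X, OrderConv x l := by
  obtain ⟨Γ, pΓ, hne, hdir, d, hd, hglb, hconv⟩ := hx
  have key : ∀ γ, ∃ α₀, ∀ α β, α₀ ≤ α → α₀ ≤ β → x α - x β ≤ d γ := by
    intro γ
    obtain ⟨p, hp⟩ := hconv γ
    obtain ⟨c, hc₁, hc₂⟩ := exists_ge_ge p.1 p.2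
    refine ⟨c, fun α β hα hβ => ?_⟩
    have h := hp (α, β) ⟨hc₁.trans hα, hc₂.trans hβ⟩
    rw [sub_zero] at h
    exact (le_abs_self _).trans h
  choose a ha using key
  have hub : ∀ γ α, a γ ≤ α → x α + d γ ∈ upperBounds {y | ∃ c, ∀ β, c ≤ β → y ≤ x β} := by
    rintro γ α hα y ⟨c, hc⟩
    obtain ⟨β, hβ₁, hβ₂⟩ := exists_ge_ge c (a γ)
    exact (hc β hβ₁).trans (sub_le_iff_le_add'.1 (ha γ β α hβ₂ hα))
  have hmem : ∀ γ α, a γ ≤ α → x α - d γ ∈ {y | ∃ c, ∀ β, c ≤ β → y ≤ x β} :=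
    fun γ α hα => ⟨a γ, fun β hβ => sub_le_comm.1 (ha γ α β hα hβ)⟩
  obtain ⟨γ₀⟩ := hne
  obtain ⟨l, hl⟩ := hX _ ⟨_, hmem γ₀ _ le_rfl⟩ ⟨_, hub γ₀ _ le_rfl⟩
  refine ⟨l, Γ, pΓ, ⟨γ₀⟩, hdir, d, hd, hglb, fun γ => ⟨a γ, fun α hα => abs_le'.2 ⟨?_, ?_⟩⟩⟩
  · exact sub_le_comm.1 (hl.1 (hmem γ α hα))
  · rw [neg_sub]
    exact sub_le_iff_le_add'.2 (hl.2 (hub γ α hα))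

/-- The order limit of an increasing net is its supremum. -/
theorem OrderConv.isLUB_of_monotone {A : Type v} [Preorder A] [IsDirected A (· ≤ ·)]
    {x : A → X} (hmono : Monotone x) {l : X} (hx : OrderConv x l) : IsLUB (range x) l := by
  obtain ⟨Γ, pΓ, -, -, d, -, hglb, hconv⟩ := hx
  constructor
  · rintro _ ⟨α, rfl⟩
    refine sub_nonpos.1 (hglb.2 ?_)
    rintro _ ⟨γ, rfl⟩
    obtain ⟨α₀, h₀⟩ := hconv γ
    obtain ⟨β, hβ₁, hβ₂⟩ := exists_ge_ge α α₀
    exact (sub_le_sub_right (hmono hβ₁) l).trans ((le_abs_self _).trans (h₀ β hβ₂))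
  · intro b hb
    refine sub_nonpos.1 (hglb.2 ?_)
    rintro _ ⟨γ, rfl⟩
    obtain ⟨α₀, h₀⟩ := hconv γ
    have h := (neg_le_abs _).trans (h₀ α₀ le_rfl)
    rw [neg_sub] at h
    exact (sub_le_sub_left (hb ⟨α₀, rfl⟩) l).trans h

/-- In an Archimedean lattice-ordered group, the gaps between a nonempty set that is bounded above
and its upper bounds have infimum `0`. -/
theorem isGLB_range_upperBounds_sub
    (hArch : ∀ x u : X, (∀ n : ℕ, n • x ≤ u) → x ≤ 0)
    {D : Set X} (hne : D.Nonempty) (hbdd : BddAbove D) :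
    IsGLB (range fun p : (upperBounds D)ᵒᵈ × D => (OrderDual.ofDual p.1).1 - p.2) 0 := by
  constructor
  · rintro _ ⟨⟨b, y⟩, rfl⟩
    exact sub_nonneg.2 (b.2 y.2)
  · intro w hw
    obtain ⟨b, hb⟩ := hbdd
    obtain ⟨y, hy⟩ := hne
    have hstep : ∀ n : ℕ, b - n • w ∈ upperBounds D := by
      intro n
      induction n with
      | zero => simpa using hb
      | succ n ih =>
        intro z hz
        have h := hw ⟨(OrderDual.toDual ⟨_, ih⟩, ⟨z, hz⟩), rfl⟩
        rw [succ_nsmul, ← sub_sub]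
        exact le_sub_comm.1 h
    exact hArch w (b - y) fun n => le_sub_comm.1 (hstep n hy)

/-- In an Archimedean lattice-ordered group, a nonempty set that is bounded above and closed under
binary suprema is an order Cauchy net. -/
theorem SupClosed.orderCauchy
    (hArch : ∀ x u : X, (∀ n : ℕ, n • x ≤ u) → x ≤ 0)
    {D : Set X} (hD : SupClosed D) (hne : D.Nonempty) (hbdd : BddAbove D) :
    OrderConv (fun p : D × D => (p.1 : X) - p.2) 0 := by
  refine ⟨(upperBounds D)ᵒᵈ × D, inferInstance, ?_, ⟨?_⟩, _, ?_,
    isGLB_range_upperBounds_sub hArch hne hbdd, ?_⟩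
  · obtain ⟨b, hb⟩ := hbdd
    obtain ⟨y, hy⟩ := hne
    exact ⟨(OrderDual.toDual ⟨b, hb⟩, ⟨y, hy⟩)⟩
  · rintro ⟨b, y⟩ ⟨c, z⟩
    refine ⟨(OrderDual.toDual ⟨(OrderDual.ofDual b).1 ⊓ (OrderDual.ofDual c).1,
      fun w hw => le_inf (b.2 hw) (c.2 hw)⟩, ⟨y ⊔ z, hD y.2 z.2⟩), ⟨?_, ?_⟩, ⟨?_, ?_⟩⟩
    · exact inf_le_left (α := X)
    · exact le_sup_left (α := X)
    · exact inf_le_right (α := X)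
    · exact le_sup_right (α := X)
  · rintro ⟨b, y⟩ ⟨c, z⟩ ⟨h₁, h₂⟩
    exact sub_le_sub (α := X) h₁ h₂
  · rintro ⟨b, y⟩
    refine ⟨(y, y), ?_⟩
    rintro ⟨v, w⟩ ⟨hv, hw⟩
    rw [sub_zero]
    refine abs_le'.2 ⟨sub_le_sub (α := X) (b.2 v.2) hw, ?_⟩
    rw [neg_sub]
    exact sub_le_sub (α := X) (b.2 w.2) hv

end OrderCauchy

/-- An Archimedean Riesz space over `ℝ` is Dedekind complete
(every nonempty subset bounded above has a supremum) iff every order Cauchy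
net order converges. -/
theorem dedekindComplete_iff_orderCauchy_converges
    {X : Type u} [Lattice X] [AddCommGroup X]
    [CovariantClass X X (· + ·) (· ≤ ·)] [Module ℝ X] [PosSMulMono ℝ X]
    (hArch : ∀ x u : X, (∀ n : ℕ, n • x ≤ u) → x ≤ 0) :
    (∀ S : Set X, S.Nonempty → BddAbove S → ∃ s : X, IsLUB S s) ↔
      ∀ (Λ : Type u) [Preorder Λ] [Nonempty Λ] [IsDirected Λ (· ≤ ·)]
        (x : Λ → X), OrderConv (fun p : Λ × Λ => x p.1 - x p.2) 0 →
          ∃ l : X, OrderConv x l := by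
  constructor
  · intro hX Λ _ _ _ x hx
    exact OrderConv.exists_of_cauchy hX hx
  · intro hX S hne hbdd
    have hD : SupClosed (supClosure S) := supClosed_supClosure
    have hneD : (supClosure S).Nonempty := hne.mono subset_supClosure
    have : Nonempty (supClosure S) := hneD.to_subtype
    have : IsDirected (supClosure S) (· ≤ ·) :=
      ⟨fun y z => ⟨⟨y ⊔ z, hD y.2 z.2⟩, le_sup_left (α := X), le_sup_right (α := X)⟩⟩
    have hbddD : BddAbove (supClosure S) := by
      rwa [BddAbove, upperBounds_supClosure]
    obtain ⟨l, hl⟩ := hX (supClosure S) (fun y => (y : X)) (hD.orderCauchy hArch hneD hbddD)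
    refine ⟨l, ?_⟩
    have h := hl.isLUB_of_monotone (Subtype.mono_coe _)
    rwa [Subtype.range_coe, isLUB_supClosure] at h
end

section
/- Let X be an Archimedean Riesz space over ℝ, (x_α)_{α∈Λ} a net in X and x ∈ X. Then (x_α) converges relatively uniformly to x if and only if there exists a set B ⊆ X that is bounded for the order convergence structure such that for every ε > 0 there is α₀ ∈ Λ with x_α − x ∈ ε • B (i.e. x_α − x = ε • b for some b ∈ B) for all α ≥ α₀. (That is, relative uniform convergence is the Mackey modification of the order convergence structure.) -/
open Filter Set Topology Pointwise

universe u v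

/-- A set `B` in a Riesz space is bounded for the order convergence structure:
for every net `(r_α)` of reals converging to `0`, the net `((α, b) ↦ r_α • b)`
indexed by `Λ × B`, preordered by the first coordinate, order converges to `0`. -/
def OrderStructureBounded {X : Type u} [Lattice X] [AddCommGroup X] [Module ℝ X]
    (B : Set X) : Prop :=
  ∀ (Λ : Type u) [Preorder Λ] [Nonempty Λ] [IsDirected Λ (· ≤ ·)]
    (r : Λ → ℝ), Filter.Tendsto r Filter.atTop (𝓝 (0 : ℝ)) →
    @OrderConv X (Λ × ↥B) _ _ (Preorder.lift (Prod.fst : Λ × ↥B → Λ))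
      (fun p => r p.1 • (p.2 : X)) 0

theorem isGLB_range_one_div_smul
    {X : Type u} [Lattice X] [AddCommGroup X] [Module ℝ X] [PosSMulMono ℝ X]
    (hArch : ∀ x u : X, (∀ n : ℕ, n • x ≤ u) → x ≤ 0) {e : X} (he : 0 ≤ e) :
    IsGLB (range fun n : ULift.{u} ℕ => (1 / ((n.down : ℝ) + 1)) • e) 0 := by
  refine ⟨?_, fun w hw => hArch w e fun n => ?_⟩
  · rintro _ ⟨n, rfl⟩
    exact smul_nonneg (by positivity) he
  · cases n with
    | zero => simpa using he
    | succ n =>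
      have hle : w ≤ (1 / ((n : ℝ) + 1)) • e := hw ⟨ULift.up n, rfl⟩
      have hpos : (0 : ℝ) < (n : ℝ) + 1 := by positivity
      have h := smul_le_smul_of_nonneg_left hle hpos.le
      rw [smul_smul, mul_one_div_cancel hpos.ne', one_smul] at h
      rw [← Nat.cast_smul_eq_nsmul ℝ]
      push_cast
      exact h

section RieszSpace

variable {X : Type u} [Lattice X] [AddCommGroup X]
    [CovariantClass X X (· + ·) (· ≤ ·)] [Module ℝ X] [PosSMulMono ℝ X]

theorem abs_smul_le_smul_of_abs_le {b e : X} {c t : ℝ} (hb : |b| ≤ e) (hc : |c| ≤ t) :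
    |c • b| ≤ t • e := by
  have nonneg : 0 ≤ e := (abs_nonneg b).trans hb
  have key : |c| • e ≤ t • e := by
    rw [← sub_nonneg, ← sub_smul]
    exact smul_nonneg (sub_nonneg.2 hc) nonneg
  refine le_trans ?_ key
  obtain ⟨h₁, h₂⟩ := abs_le'.1 hb
  rcases le_total 0 c with h | h
  · rw [abs_of_nonneg h, abs_le', ← smul_neg]
    exact ⟨smul_le_smul_of_nonneg_left h₁ h, smul_le_smul_of_nonneg_left h₂ h⟩
  · rw [abs_of_nonpos h, abs_le', ← neg_smul, ← neg_smul_neg c b]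
    have h' := neg_nonneg.2 h
    exact ⟨smul_le_smul_of_nonneg_left h₂ h', smul_le_smul_of_nonneg_left h₁ h'⟩

/-- In an Archimedean Riesz space, order intervals are bounded for order convergence. -/
theorem orderStructureBounded_setOf_abs_le
    (hArch : ∀ x u : X, (∀ n : ℕ, n • x ≤ u) → x ≤ 0) {e : X} (he : 0 ≤ e) :
    OrderStructureBounded {b : X | |b| ≤ e} := by
  intro Λ _ _ _ r hr
  refine ⟨ULift.{u} ℕ, inferInstance, inferInstance, inferInstance,
    fun n => (1 / ((n.down : ℝ) + 1)) • e, fun m n hmn => ?_,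
    isGLB_range_one_div_smul hArch he, fun n => ?_⟩
  · rw [← sub_nonneg, ← sub_smul]
    exact smul_nonneg (sub_nonneg.2 (Nat.one_div_le_one_div hmn)) he
  · obtain ⟨α₀, h⟩ := eventually_atTop.1
      (Metric.tendsto_nhds.1 hr _ (Nat.one_div_pos_of_nat (α := ℝ) (n := n.down)))
    refine ⟨(α₀, ⟨0, by simpa using he⟩), fun p hp => ?_⟩
    have hr' := h p.1 hp
    rw [Real.dist_eq, sub_zero] at hr'
    rw [sub_zero]
    exact abs_smul_le_smul_of_abs_le p.2.2 hr'.le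

/-- Sets that are bounded for order convergence are order bounded. -/
theorem OrderStructureBounded.exists_abs_le {B : Set X} (hB : OrderStructureBounded B) :
    ∃ e : X, 0 ≤ e ∧ ∀ b ∈ B, |b| ≤ e := by
  have hr : Tendsto (fun n : ULift.{u} ℕ => 1 / ((n.down : ℝ) + 1)) atTop (𝓝 0) :=
    tendsto_one_div_add_atTop_nhds_zero_nat.comp
      (tendsto_atTop.2 fun n => eventually_atTop.2 ⟨ULift.up n, fun _ h => h⟩)
  obtain ⟨Γ, _, ⟨γ⟩, _, d, _, hd, h⟩ := hB (ULift.{u} ℕ) _ hr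
  obtain ⟨p, hp⟩ := h γ
  have hpos : (0 : ℝ) < (p.1.down : ℝ) + 1 := by positivity
  refine ⟨((p.1.down : ℝ) + 1) • d γ, smul_nonneg hpos.le (hd.1 ⟨γ, rfl⟩), fun b hb => ?_⟩
  have hle := hp (p.1, ⟨b, hb⟩) (le_refl p.1)
  rw [sub_zero] at hle
  have h' := abs_smul_le_smul_of_abs_le hle (abs_of_pos hpos).le
  rwa [smul_smul, mul_one_div_cancel hpos.ne', one_smul] at h'

end RieszSpace

/-- In an Archimedean Riesz space over `ℝ`, a net `(x_α)`
converges relatively uniformly to `x` iff there is a set `B`, bounded for the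
order convergence structure, such that for every `ε > 0` a tail of
`(x_α - x)` is contained in `ε • B`.  (Relative uniform convergence is the
Mackey modification of order convergence.) -/
theorem relUnifConv_iff_mackey_of_orderConvergence
    {X : Type u} [Lattice X] [AddCommGroup X]
    [CovariantClass X X (· + ·) (· ≤ ·)] [Module ℝ X] [PosSMulMono ℝ X]
    (hArch : ∀ x u : X, (∀ n : ℕ, n • x ≤ u) → x ≤ 0)
    {Λ : Type v} [Preorder Λ] [Nonempty Λ] [IsDirected Λ (· ≤ ·)]
    (x : Λ → X) (l : X) :
    (∃ e : X, 0 ≤ e ∧ ∀ ε : ℝ, 0 < ε →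
        ∃ α₀ : Λ, ∀ α : Λ, α₀ ≤ α → |x α - l| ≤ ε • e) ↔
      ∃ B : Set X, OrderStructureBounded B ∧
        ∀ ε : ℝ, 0 < ε → ∃ α₀ : Λ, ∀ α : Λ, α₀ ≤ α → x α - l ∈ ε • B := by
  constructor
  · rintro ⟨e, he, h⟩
    refine ⟨{b | |b| ≤ e}, orderStructureBounded_setOf_abs_le hArch he, fun ε hε => ?_⟩
    obtain ⟨α₀, hα₀⟩ := h ε hε
    refine ⟨α₀, fun α hα => (mem_smul_set_iff_inv_smul_mem₀ hε.ne' _ _).2 ?_⟩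
    have h' := abs_smul_le_smul_of_abs_le (hα₀ α hα) (abs_of_pos (inv_pos.2 hε)).le
    rwa [inv_smul_smul₀ hε.ne'] at h'
  · rintro ⟨B, hB, h⟩
    obtain ⟨e, he, hBe⟩ := hB.exists_abs_le
    refine ⟨e, he, fun ε hε => ?_⟩
    obtain ⟨α₀, hα₀⟩ := h ε hε
    refine ⟨α₀, fun α hα => ?_⟩
    obtain ⟨b, hb, hbx⟩ := hα₀ α hα
    rw [← hbx]
    exact abs_smul_le_smul_of_abs_le (hBe b hb) (abs_of_pos hε).le
end

section
/- Let X be a Riesz space over ℝ, U ⊆ X and x ∈ X. The following are equivalent: (1) U is an order neighborhood of x: every net in X that order converges to x has some tail set contained in U; (2) for every net (u_α)_{α∈Λ} in X with u_α ↓ 0 (decreasing with infimum 0), there exists α₀ ∈ Λ such that the order interval [x − u_α, x + u_α] is contained in U for all α ≥ α₀. -/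
open Filter Set Topology

universe u v

/-- In a lattice ordered group, `z` lies in the order interval `[x - u, x + u]` iff
`|z - x| ≤ u`. -/
theorem mem_Icc_sub_add_iff_abs_sub_le {X : Type*} [Lattice X] [AddCommGroup X]
    [CovariantClass X X (· + ·) (· ≤ ·)] (x z u : X) :
    z ∈ Set.Icc (x - u) (x + u) ↔ |z - x| ≤ u := by
  have : IsOrderedAddMonoid X :=
    { add_le_add_left := fun a b h c => by
        simpa only [add_comm _ c] using
          (CovariantClass.elim c h : c + a ≤ c + b) }
  rw [Set.mem_Icc, abs_le', neg_sub, sub_le_comm, and_comm (a := z - x ≤ u),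
    sub_le_iff_le_add' (a := z)]

/-- A point of one of the order intervals `[x - d α, x + d α]`, together with the index `α`. -/
structure IntervalPoint {X : Type u} {Λ : Type v} [Lattice X] [AddCommGroup X]
    (x : X) (d : Λ → X) where
  /-- The index of the interval. -/
  index : Λ
  /-- The point of the interval. -/
  point : X
  mem_Icc : point ∈ Set.Icc (x - d index) (x + d index)

/-- Points of intervals are compared through the indices of the intervals only. -/
instance IntervalPoint.instPreorder {X : Type u} {Λ : Type v} [Lattice X] [AddCommGroup X]
    [Preorder Λ] (x : X) (d : Λ → X) : Preorder (IntervalPoint x d) :=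
  Preorder.lift IntervalPoint.index

/-- In a Riesz space over `ℝ`, a set `U` is an order
neighborhood of `x` (every net order converging to `x` has a tail in `U`) iff
for every net `u_α ↓ 0` there is `α₀` with `[x - u_α, x + u_α] ⊆ U` for all
`α ≥ α₀`. -/
theorem order_neighborhood_iff_net_catching
    {X : Type u} [Lattice X] [AddCommGroup X]
    [CovariantClass X X (· + ·) (· ≤ ·)] [Module ℝ X] [PosSMulMono ℝ X]
    (U : Set X) (x : X) :
    (∀ (Λ : Type u) [Preorder Λ] [Nonempty Λ] [IsDirected Λ (· ≤ ·)]
      (y : Λ → X), OrderConv y x → ∃ α₀ : Λ, ∀ α : Λ, α₀ ≤ α → y α ∈ U) ↔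
    (∀ (Λ : Type u) [Preorder Λ] [Nonempty Λ] [IsDirected Λ (· ≤ ·)]
      (d : Λ → X), Antitone d → IsGLB (Set.range d) 0 →
        ∃ α₀ : Λ, ∀ α : Λ, α₀ ≤ α → Set.Icc (x - d α) (x + d α) ⊆ U) := by
  constructor
  · intro hU Λ _ _ _ d hd hglb
    have hpos : ∀ α, 0 ≤ d α := fun α => hglb.1 ⟨α, rfl⟩
    have hx : ∀ α, x ∈ Set.Icc (x - d α) (x + d α) := fun α => by
      rw [mem_Icc_sub_add_iff_abs_sub_le, sub_self]
      simpa [abs] using hpos α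
    have : Nonempty (IntervalPoint x d) := ‹Nonempty Λ›.map fun α => ⟨α, x, hx α⟩
    have : IsDirected (IntervalPoint x d) (· ≤ ·) := ⟨fun p q => by
      obtain ⟨γ, hp, hq⟩ := exists_ge_ge p.index q.index
      exact ⟨⟨γ, x, hx γ⟩, hp, hq⟩⟩
    obtain ⟨p, hp⟩ := hU (IntervalPoint x d) IntervalPoint.point
      ⟨Λ, inferInstance, inferInstance, inferInstance, d, fun _ _ h => hd h, hglb,
        fun γ => ⟨⟨γ, x, hx γ⟩, fun q hq =>
          ((mem_Icc_sub_add_iff_abs_sub_le _ _ _).1 q.mem_Icc).trans (hd hq)⟩⟩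
    exact ⟨p.index, fun α hα z hz => hp ⟨α, z, hz⟩ hα⟩
  · rintro hU Λ _ _ _ y ⟨Γ, _, _, _, d, hd, hglb, hy⟩
    obtain ⟨γ, hγ⟩ := hU Γ d (fun _ _ h => hd _ _ h) hglb
    obtain ⟨α₀, hα₀⟩ := hy γ
    exact ⟨α₀, fun α hα =>
      hγ γ le_rfl ((mem_Icc_sub_add_iff_abs_sub_le _ _ _).2 (hα₀ α hα))⟩
end

section
/- Let X be an Archimedean Riesz space over ℝ. There exists a topology τ on X such that, for every net (x_α) in X and every x ∈ X, x_α → x in τ if and only if x_α →o x, if and only if X is finite-dimensional as a real vector space. (That is, order convergence on an Archimedean vector lattice is topological iff the space is finite-dimensional.) -/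
open Filter Set Topology

universe u v

section RieszSpace

variable {X : Type*} [Lattice X] [AddCommGroup X]

/-- An element `a > 0` such that no two elements of `(0, a]` are disjoint. -/
def IsRieszAtom {X : Type*} [Lattice X] [AddCommGroup X] (a : X) : Prop :=
  0 < a ∧ ∀ p q : X, 0 < p → p ≤ a → 0 < q → q ≤ a → p ⊓ q ≠ 0

theorem IsRieszAtom.disjoint_or_disjoint {a p q : X} (ha : IsRieszAtom a) (hp : 0 ≤ p)
    (hq : 0 ≤ q) (hpq : p ⊓ q = 0) : p ⊓ a = 0 ∨ q ⊓ a = 0 := by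
  by_contra! h
  have hpa : 0 ≤ p ⊓ a := le_inf hp ha.1.le
  have hqa : 0 ≤ q ⊓ a := le_inf hq ha.1.le
  refine ha.2 (p ⊓ a) (q ⊓ a) (hpa.lt_of_ne' h.1) inf_le_right (hqa.lt_of_ne' h.2)
    inf_le_right ?_
  exact le_antisymm ((inf_le_inf inf_le_left inf_le_left).trans hpq.le) (le_inf hpa hqa)

theorem exists_disjoint_seq_of_forall_not_isRieszAtom {x : X} (hx : 0 < x)
    (h : ∀ a, a ≤ x → ¬ IsRieszAtom a) :
    ∃ e : ℕ → X, (∀ n, 0 < e n) ∧ Pairwise fun m n => e m ⊓ e n = 0 := by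
  have hsplit : ∀ y : Set.Ioc 0 x, ∃ p q : Set.Ioc 0 x, (p : X) ≤ y ∧ q ≤ y ∧
      (p : X) ⊓ (q : X) = 0 := by
    rintro ⟨y, hy0, hyx⟩
    have := h y hyx
    simp only [IsRieszAtom, hy0, true_and] at this
    push Not at this
    obtain ⟨p, q, hp, hpy, hq, hqy, hpq⟩ := this
    exact ⟨⟨p, hp, hpy.trans hyx⟩, ⟨q, hq, hqy.trans hyx⟩, hpy, hqy, hpq⟩
  choose p q hp hq hpq using hsplit
  let y : ℕ → Set.Ioc 0 x := fun n => q^[n] ⟨x, hx, le_rfl⟩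
  have hy : ∀ n, y (n + 1) = q (y n) := fun n => Function.iterate_succ_apply' q n _
  have hanti : Antitone y := antitone_nat_of_succ_le fun n => (hy n).trans_le (hq _)
  have hlt : ∀ m n, m < n → (p (y m) : X) ⊓ (p (y n) : X) = 0 := fun m n hmn => by
    refine le_antisymm ?_ (le_inf (p _).2.1.le (p _).2.1.le)
    refine (inf_le_inf_left _ ?_).trans (hpq (y m)).le
    rw [← hy]
    exact (hp (y n)).trans (hanti hmn)
  refine ⟨fun n => p (y n), fun n => (p (y n)).2.1, fun m n hmn => ?_⟩
  rcases hmn.lt_or_gt with h' | h'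
  · exact hlt m n h'
  · simpa only [inf_comm] using hlt n m h'

theorem le_zero_of_forall_le_smul [Module ℝ X] [PosSMulMono ℝ X]
    (hArch : ∀ x u : X, (∀ n : ℕ, n • x ≤ u) → x ≤ 0) {x u : X}
    (hu : 0 ≤ u) (h : ∀ ε : ℝ, 0 < ε → x ≤ ε • u) : x ≤ 0 := by
  refine hArch x u fun n => ?_
  rcases Nat.eq_zero_or_pos n with rfl | hn
  · simpa using hu
  · have hn' : (0 : ℝ) < n := by exact_mod_cast hn
    calc n • x = (n : ℝ) • x := (Nat.cast_smul_eq_nsmul ℝ n x).symm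
      _ ≤ (n : ℝ) • (n : ℝ)⁻¹ • u :=
        smul_le_smul_of_nonneg_left (h _ (inv_pos.2 hn')) hn'.le
      _ = u := smul_inv_smul₀ hn'.ne' u

theorem abs_smul_le_smul_abs [Module ℝ X] [PosSMulMono ℝ X] (c : ℝ) (x : X) :
    |c • x| ≤ |c| • |x| := by
  rcases le_total 0 c with h | h
  · rw [abs_of_nonneg h, abs_le', ← smul_neg]
    exact ⟨smul_le_smul_of_nonneg_left (le_abs_self x) h,
      smul_le_smul_of_nonneg_left (neg_le_abs x) h⟩
  · rw [abs_of_nonpos h, abs_le', ← neg_smul, ← neg_smul_neg c x]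
    exact ⟨smul_le_smul_of_nonneg_left (neg_le_abs x) (neg_nonneg.2 h),
      smul_le_smul_of_nonneg_left (le_abs_self x) (neg_nonneg.2 h)⟩

variable [IsOrderedAddMonoid X]

theorem add_inf_eq_zero_of_disjoint {x y c : X} (hx : 0 ≤ x) (hy : 0 ≤ y) (hc : 0 ≤ c)
    (hxc : x ⊓ c = 0) (hyc : y ⊓ c = 0) : (x + y) ⊓ c = 0 := by
  refine le_antisymm ?_ (le_inf (add_nonneg hx hy) hc)
  have h : (x + y) ⊓ c - y ≤ x ⊓ c :=
    le_inf (sub_le_iff_le_add.2 inf_le_left)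
      (sub_le_iff_le_add.2 (inf_le_right.trans (le_add_of_nonneg_right hy)))
  rw [hxc, sub_nonpos] at h
  exact (le_inf h inf_le_right).trans hyc.le

theorem sum_range_inf_eq_zero_of_disjoint {e : ℕ → X} (he : ∀ n, 0 ≤ e n)
    (hdisj : Pairwise fun m n => e m ⊓ e n = 0) {n m : ℕ} (hnm : n ≤ m) :
    (∑ i ∈ Finset.range n, e i) ⊓ e m = 0 := by
  induction n with
  | zero => simpa using he m
  | succ n ih =>
    rw [Finset.sum_range_succ]
    exact add_inf_eq_zero_of_disjoint (Finset.sum_nonneg fun i _ => he i) (he n) (he m)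
      (ih (by omega)) (hdisj (by omega))

theorem sum_range_le_of_disjoint {e : ℕ → X} (he : ∀ n, 0 ≤ e n)
    (hdisj : Pairwise fun m n => e m ⊓ e n = 0) {u : X} (hu : ∀ n, e n ≤ u) (n : ℕ) :
    ∑ i ∈ Finset.range n, e i ≤ u := by
  induction n with
  | zero => simpa using (he 0).trans (hu 0)
  | succ n ih =>
    rw [Finset.sum_range_succ, ← inf_add_sup,
      sum_range_inf_eq_zero_of_disjoint he hdisj le_rfl, zero_add]
    exact sup_le ih (hu n)

/-- In an Archimedean Riesz space, the differences between the upper bounds of a nonempty order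
bounded set and the elements of that set have infimum zero. -/
theorem le_zero_of_forall_le_upperBounds_sub (hArch : ∀ x u : X, (∀ n : ℕ, n • x ≤ u) → x ≤ 0)
    {s : Set X} (hs : s.Nonempty) (hb : (upperBounds s).Nonempty) {w : X}
    (hw : ∀ b ∈ upperBounds s, ∀ x ∈ s, w ≤ b - x) : w ≤ 0 := by
  obtain ⟨x, hx⟩ := hs
  obtain ⟨b, hb⟩ := hb
  refine hArch w (b - x) fun n => ?_
  suffices h : b - n • w ∈ upperBounds s from le_sub_comm.1 (h hx)
  induction n with
  | zero => simpa using hb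
  | succ n ih =>
    intro y hy
    have := hw _ ih y hy
    rw [succ_nsmul, ← sub_sub]
    exact le_sub_comm.1 this

variable [Module ℝ X] [PosSMulMono ℝ X]

theorem smul_inf_eq_zero_of_disjoint {x y : X} {c : ℝ} (hc : 0 ≤ c) (hx : 0 ≤ x) (hy : 0 ≤ y)
    (h : x ⊓ y = 0) : (c • x) ⊓ y = 0 := by
  refine le_antisymm ?_ (le_inf (smul_nonneg hc hx) hy)
  set z := (c • x) ⊓ y
  have hc1 : (0 : ℝ) < c + 1 := by linarith
  have hz : 0 ≤ z := le_inf (smul_nonneg hc hx) hy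
  have h1 : (c + 1)⁻¹ • z ≤ x := by
    have : z ≤ (c + 1) • x :=
      inf_le_left.trans (smul_le_smul_of_nonneg_right (by linarith) hx)
    calc (c + 1)⁻¹ • z ≤ (c + 1)⁻¹ • (c + 1) • x :=
          smul_le_smul_of_nonneg_left this (inv_nonneg.2 hc1.le)
      _ = x := inv_smul_smul₀ hc1.ne' x
  have h2 : (c + 1)⁻¹ • z ≤ y := by
    calc (c + 1)⁻¹ • z ≤ (1 : ℝ) • z :=
          smul_le_smul_of_nonneg_right (inv_le_one_of_one_le₀ (by linarith)) hz
      _ ≤ y := by rw [one_smul]; exact inf_le_right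
  have h3 : (c + 1)⁻¹ • z ≤ 0 := (le_inf h1 h2).trans h.le
  calc z = (c + 1) • (c + 1)⁻¹ • z := (smul_inv_smul₀ hc1.ne' z).symm
    _ ≤ (c + 1) • (0 : X) := smul_le_smul_of_nonneg_left h3 hc1.le
    _ = 0 := smul_zero _

theorem IsRieszAtom.exists_smul_le (hArch : ∀ x u : X, (∀ n : ℕ, n • x ≤ u) → x ≤ 0) {a x : X}
    (ha : IsRieszAtom a) (hx : 0 ≤ x) :
    ∃ c : ℝ, 0 ≤ c ∧ c • a ≤ x ∧ (x - c • a) ⊓ a = 0 := by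
  set S : Set ℝ := {c | c • a ≤ x}
  have h0 : (0 : ℝ) ∈ S := by simpa [S] using hx
  have hbdd : BddAbove S := by
    by_contra hS
    rw [not_bddAbove_iff] at hS
    refine ha.1.not_ge (hArch a x fun n => ?_)
    obtain ⟨c, hc, hnc⟩ := hS n
    rw [← Nat.cast_smul_eq_nsmul ℝ]
    exact (smul_le_smul_of_nonneg_right hnc.le ha.1.le).trans hc
  have hle : sSup S • a ≤ x := by
    refine sub_nonpos.1 (le_zero_of_forall_le_smul hArch ha.1.le fun ε hε => ?_)
    obtain ⟨c, hc, hlt⟩ := exists_lt_of_lt_csSup ⟨0, h0⟩ (sub_lt_self (sSup S) hε)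
    rw [sub_le_iff_le_add]
    calc sSup S • a ≤ (ε + c) • a := smul_le_smul_of_nonneg_right (by linarith) ha.1.le
      _ = ε • a + c • a := add_smul _ _ _
      _ ≤ ε • a + x := by gcongr; exact hc
  refine ⟨sSup S, le_csSup hbdd h0, hle, le_antisymm ?_ (le_inf (sub_nonneg.2 hle) ha.1.le)⟩
  refine le_zero_of_forall_le_smul hArch ha.1.le fun ε hε => ?_
  set c := sSup S + ε with hcdef
  have hc0 : 0 ≤ c := add_nonneg (le_csSup hbdd h0) hε.le
  rcases ha.disjoint_or_disjoint (posPart_nonneg (x - c • a)) (negPart_nonneg (x - c • a))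
    (posPart_inf_negPart_eq_zero _) with h | h
  · rw [← sub_nonpos]
    refine (le_inf ?_ ?_).trans h.le
    · refine le_trans ?_ (le_posPart _)
      rw [hcdef, add_smul, ← sub_sub]
      exact sub_le_sub_right inf_le_left _
    · exact (sub_le_self _ (smul_nonneg hε.le ha.1.le)).trans inf_le_right
  · exfalso
    have h1 : (x - c • a)⁻ ≤ c • a := by
      rw [negPart_def, neg_sub]
      exact sup_le (sub_le_self _ hx) (smul_nonneg hc0 ha.1.le)
    have h2 := smul_inf_eq_zero_of_disjoint hc0 ha.1.le (negPart_nonneg (x - c • a))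
      (by rwa [inf_comm])
    rw [inf_eq_right.2 h1, negPart_eq_zero, sub_nonneg] at h2
    have := le_csSup hbdd (show c ∈ S from h2)
    linarith

theorem exists_mem_span_sub_disjoint (hArch : ∀ x u : X, (∀ n : ℕ, n • x ≤ u) → x ≤ 0)
    (s : Finset X) (hs : ∀ a ∈ s, IsRieszAtom a) {x : X} (hx : 0 ≤ x) :
    ∃ z ∈ Submodule.span ℝ (s : Set X), 0 ≤ x - z ∧ ∀ a ∈ s, (x - z) ⊓ a = 0 := by
  classical
  induction s using Finset.induction_on with
  | empty => exact ⟨0, zero_mem _, by simpa using hx, by simp⟩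
  | insert b s _ ih =>
    obtain ⟨z, hz, hz0, hzs⟩ := ih fun a ha => hs a (Finset.mem_insert_of_mem ha)
    obtain ⟨c, hc0, hc, hcb⟩ := (hs b (Finset.mem_insert_self b s)).exists_smul_le hArch hz0
    refine ⟨z + c • b, add_mem (Submodule.span_mono (by simp) hz)
      (Submodule.smul_mem _ _ (Submodule.subset_span (by simp))), ?_, fun a ha => ?_⟩
    · rwa [← sub_sub, sub_nonneg]
    · have hb := (hs b (Finset.mem_insert_self b s)).1.le
      rw [← sub_sub]
      rcases Finset.mem_insert.1 ha with rfl | has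
      · exact hcb
      · refine le_antisymm ?_ (le_inf (sub_nonneg.2 hc) (hs a ha).1.le)
        exact (inf_le_inf_right _ (sub_le_self _ (smul_nonneg hc0 hb))).trans (hzs a has).le

/-- An Archimedean Riesz space in which there is no disjoint sequence of positive elements is
finite dimensional. -/
theorem finiteDimensional_or_exists_disjoint_seq
    (hArch : ∀ x u : X, (∀ n : ℕ, n • x ≤ u) → x ≤ 0) :
    FiniteDimensional ℝ X ∨
      ∃ e : ℕ → X, (∀ n, 0 < e n) ∧ Pairwise fun m n => e m ⊓ e n = 0 := by
  by_contra! hcon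
  obtain ⟨hfin, hseq⟩ := hcon
  have hatom : ∀ x : X, 0 < x → ∃ a, a ≤ x ∧ IsRieszAtom a := by
    intro x hx
    by_contra! h
    obtain ⟨e, he, hd⟩ := exists_disjoint_seq_of_forall_not_isRieszAtom hx h
    exact hseq e he hd
  have : Std.Symm fun x y : X => x ⊓ y = 0 := ⟨fun x y h => by rwa [inf_comm]⟩
  refine hfin ?_
  by_cases hs : ∀ s : Finset X, (∀ x ∈ s, IsRieszAtom x) →
      ∃ y, IsRieszAtom y ∧ ∀ x ∈ s, x ⊓ y = 0
  · obtain ⟨e, he, hd⟩ := exists_seq_of_forall_finset_exists' IsRieszAtom _ hs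
    exact absurd hd (hseq e fun n => (he n).1)
  push Not at hs
  obtain ⟨s, hs, hmax⟩ := hs
  have hpos : ∀ x : X, 0 ≤ x → x ∈ Submodule.span ℝ (s : Set X) := by
    intro x hx
    obtain ⟨z, hz, hz0, hd⟩ := exists_mem_span_sub_disjoint hArch s hs hx
    suffices x - z = 0 by rwa [sub_eq_zero.1 this]
    by_contra hne
    obtain ⟨a, hax, ha⟩ := hatom _ (hz0.lt_of_ne' hne)
    obtain ⟨b, hb, hba⟩ := hmax a ha
    refine hba (le_antisymm ?_ (le_inf (hs b hb).1.le ha.1.le))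
    rw [inf_comm, ← hd b hb]
    exact inf_le_inf_right _ hax
  refine ⟨s, eq_top_iff.2 fun x _ => ?_⟩
  rw [← posPart_sub_negPart x]
  exact sub_mem (hpos _ (posPart_nonneg x)) (hpos _ (negPart_nonneg x))

theorem exists_smul_not_le_of_pos (hArch : ∀ x u : X, (∀ n : ℕ, n • x ≤ u) → x ≤ 0) {f u : X}
    (hf : 0 < f) {r : ℝ} (hfu : f ≤ r • u) (hr : 0 < r) :
    ∃ c : ℝ, 0 ≤ c ∧ ¬ c • f ≤ u ∧ c • f ≤ u + u := by
  have hg0 : ¬ r⁻¹ • f ≤ 0 := fun h => hf.not_ge <| by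
    simpa [smul_inv_smul₀ hr.ne'] using smul_le_smul_of_nonneg_left h hr.le
  have hgu : r⁻¹ • f ≤ u := by
    simpa [inv_smul_smul₀ hr.ne'] using smul_le_smul_of_nonneg_left hfu (inv_nonneg.2 hr.le)
  have hex : ∃ n : ℕ, ¬ n • r⁻¹ • f ≤ u := by
    by_contra! h
    exact hg0 (hArch _ _ h)
  obtain ⟨n, hn, hmin⟩ : ∃ n : ℕ, ¬ n • r⁻¹ • f ≤ u ∧ ∀ m < n, m • r⁻¹ • f ≤ u := by
    classical
    exact ⟨Nat.find hex, Nat.find_spec hex, fun m hm => not_not.1 (Nat.find_min hex hm)⟩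
  have hcast : ((n : ℝ) * r⁻¹) • f = n • r⁻¹ • f := by rw [mul_smul, Nat.cast_smul_eq_nsmul]
  refine ⟨n * r⁻¹, by positivity, by rwa [hcast], ?_⟩
  rw [hcast]
  cases n with
  | zero =>
    have : (0 : X) ≤ u := (smul_nonneg (inv_nonneg.2 hr.le) hf.le).trans hgu
    simpa using add_nonneg this this
  | succ n =>
    rw [succ_nsmul]
    exact add_le_add (hmin n n.lt_succ_self) hgu

theorem isGLB_range_inv_smul (hArch : ∀ x u : X, (∀ n : ℕ, n • x ≤ u) → x ≤ 0) {u : X}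
    (hu : 0 ≤ u) :
    IsGLB (Set.range fun n : ULift.{v} ℕ => ((n.down : ℝ) + 1)⁻¹ • u) 0 := by
  constructor
  · rintro _ ⟨n, rfl⟩
    exact smul_nonneg (by positivity) hu
  · intro w hw
    refine le_zero_of_forall_le_smul hArch hu fun ε hε => ?_
    obtain ⟨n, hn⟩ := exists_nat_one_div_lt hε
    rw [one_div] at hn
    exact (hw ⟨⟨n⟩, rfl⟩).trans (smul_le_smul_of_nonneg_right hn.le hu)

theorem inv_smul_le_inv_smul {u : X} (hu : 0 ≤ u) {m n : ℕ} (h : m ≤ n) :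
    ((n : ℝ) + 1)⁻¹ • u ≤ ((m : ℝ) + 1)⁻¹ • u :=
  smul_le_smul_of_nonneg_right (by gcongr) hu

end RieszSpace

section Topological

variable {X : Type u} [Lattice X] [AddCommGroup X]

/-- A neighbourhood of `a` with a chosen point in it. -/
structure PointedNhd {Y : Type*} [TopologicalSpace Y] (a : Y) where
  /-- the neighbourhood -/
  set : Set Y
  mem_nhds : set ∈ 𝓝 a
  /-- the chosen point -/
  point : Y
  point_mem : point ∈ set

namespace PointedNhd

variable {Y : Type*} [TopologicalSpace Y] {a : Y}

/-- A neighbourhood of `a` pointed at `a`. -/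
def center (U : Set Y) (hU : U ∈ 𝓝 a) : PointedNhd a := ⟨U, hU, a, mem_of_mem_nhds hU⟩

instance : Preorder (PointedNhd a) where
  le p q := q.set ⊆ p.set
  le_refl p := subset_refl p.set
  le_trans _ _ _ hpq hqr := hqr.trans hpq

instance : Nonempty (PointedNhd a) := ⟨center Set.univ univ_mem⟩

instance : IsDirected (PointedNhd a) (· ≤ ·) :=
  ⟨fun p q => ⟨center (p.set ∩ q.set) (inter_mem p.mem_nhds q.mem_nhds),
    Set.inter_subset_left, Set.inter_subset_right⟩⟩

end PointedNhd

/-- If order convergence to `0` is implied by convergence for a topology, then some neighbourhood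
of `0` is order bounded. -/
theorem exists_eventually_abs_le_of_tendsto_imp_orderConv [TopologicalSpace X]
    (hτ : ∀ (Λ : Type u) [Preorder Λ] [Nonempty Λ] [IsDirected Λ (· ≤ ·)] (x : Λ → X),
      Tendsto x atTop (𝓝 0) → OrderConv x 0) :
    ∃ u : X, ∀ᶠ y in 𝓝 (0 : X), |y| ≤ u := by
  have ht : Tendsto (fun p : PointedNhd (0 : X) => p.point) atTop (𝓝 0) := fun U hU =>
    mem_atTop_sets.2 ⟨.center U hU, fun p hp => hp p.point_mem⟩
  obtain ⟨Γ, _, ⟨γ⟩, _, d, _, _, hd⟩ := hτ _ _ ht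
  obtain ⟨p, hp⟩ := hd γ
  refine ⟨d γ, mem_of_superset p.mem_nhds fun y hy => ?_⟩
  simpa using hp ⟨p.set, p.mem_nhds, y, hy⟩ (subset_refl p.set)

variable [IsOrderedAddMonoid X]

theorem orderConv_zero_of_antitone {Λ : Type u} [Preorder Λ] [Nonempty Λ]
    [hΛ : IsDirected Λ (· ≤ ·)] {d : Λ → X} (hd : Antitone d) (h0 : IsGLB (Set.range d) 0) :
    OrderConv d 0 := by
  refine ⟨Λ, inferInstance, inferInstance, hΛ, d, fun _ _ h => hd h, h0,
    fun γ => ⟨γ, fun α hα => ?_⟩⟩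
  rw [sub_zero, abs_of_nonneg (h0.1 ⟨α, rfl⟩)]
  exact hd hα

/-- The net of differences between upper bounds of a bounded monotone sequence and its terms
order converges to zero. -/
theorem orderConv_upperBounds_sub (hArch : ∀ x u : X, (∀ n : ℕ, n • x ≤ u) → x ≤ 0) {s : ℕ → X}
    (hs : Monotone s) (hb : (upperBounds (Set.range s)).Nonempty)
    [Nonempty ((upperBounds (Set.range s))ᵒᵈ × ℕ)]
    [IsDirected ((upperBounds (Set.range s))ᵒᵈ × ℕ) (· ≤ ·)] :
    OrderConv (fun p : (upperBounds (Set.range s))ᵒᵈ × ℕ =>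
      (OrderDual.ofDual p.1).1 - s p.2) 0 := by
  refine orderConv_zero_of_antitone (fun p q hpq => sub_le_sub hpq.1 (hs hpq.2)) ⟨?_, ?_⟩
  · rintro _ ⟨⟨b, n⟩, rfl⟩
    exact sub_nonneg.2 ((OrderDual.ofDual b).2 ⟨n, rfl⟩)
  · intro w hw
    refine le_zero_of_forall_le_upperBounds_sub hArch (Set.range_nonempty s) hb ?_
    rintro b hb _ ⟨n, rfl⟩
    exact hw ⟨(OrderDual.toDual ⟨b, hb⟩, n), rfl⟩

variable [Module ℝ X] [PosSMulMono ℝ X]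

theorem finiteDimensional_of_orderConv_iff_tendsto
    (hArch : ∀ x u : X, (∀ n : ℕ, n • x ≤ u) → x ≤ 0) [TopologicalSpace X]
    (hτ : ∀ (Λ : Type u) [Preorder Λ] [Nonempty Λ] [IsDirected Λ (· ≤ ·)] (x : Λ → X),
      Tendsto x atTop (𝓝 0) ↔ OrderConv x 0) :
    FiniteDimensional ℝ X := by
  obtain ⟨u, hu⟩ := exists_eventually_abs_le_of_tendsto_imp_orderConv
    fun Λ _ _ _ x => (hτ Λ x).1
  have hunit : ∀ x : X, 0 ≤ x → ∃ r : ℝ, 0 < r ∧ x ≤ r • u := by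
    intro x hx
    have h := (hτ _ _).2 (orderConv_zero_of_antitone (Λ := ULift.{u} ℕ)
      (fun m n hmn => inv_smul_le_inv_smul hx hmn) (isGLB_range_inv_smul hArch hx))
    obtain ⟨n, hn⟩ := (h.eventually hu).exists
    have hpos : (0 : ℝ) < (n.down : ℝ) + 1 := by positivity
    refine ⟨n.down + 1, hpos, ?_⟩
    simpa [smul_inv_smul₀ hpos.ne'] using
      smul_le_smul_of_nonneg_left ((le_abs_self _).trans hn) hpos.le
  refine (finiteDimensional_or_exists_disjoint_seq hArch).resolve_right ?_
  rintro ⟨f, hf, hdisj⟩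
  have hc : ∀ n, ∃ c : ℝ, 0 ≤ c ∧ ¬ c • f n ≤ u ∧ c • f n ≤ u + u := fun n => by
    obtain ⟨r, hr, hfr⟩ := hunit (f n) (hf n).le
    exact exists_smul_not_le_of_pos hArch (hf n) hfr hr
  choose c hc0 hcu hcu2 using hc
  have he : ∀ n, 0 ≤ c n • f n := fun n => smul_nonneg (hc0 n) (hf n).le
  have hdisj' : Pairwise fun m n => (c m • f m) ⊓ (c n • f n) = 0 := fun m n hmn => by
    refine smul_inf_eq_zero_of_disjoint (hc0 m) (hf m).le (he n) ?_
    rw [inf_comm]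
    exact smul_inf_eq_zero_of_disjoint (hc0 n) (hf n).le (hf m).le (hdisj hmn.symm)
  set s : ℕ → X := fun n => ∑ i ∈ Finset.range n, c i • f i with hsdef
  have hs : Monotone s := monotone_nat_of_le_succ fun n => by
    simp only [hsdef, Finset.sum_range_succ]
    exact le_add_of_nonneg_right (he n)
  have hb : u + u ∈ upperBounds (Set.range s) := by
    rintro _ ⟨n, rfl⟩
    exact sum_range_le_of_disjoint he hdisj' hcu2 n
  have : Nonempty (upperBounds (Set.range s))ᵒᵈ := ⟨OrderDual.toDual ⟨_, hb⟩⟩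
  have : IsDirected ((upperBounds (Set.range s))ᵒᵈ × ℕ) (· ≤ ·) := ⟨fun p q =>
    ⟨(OrderDual.toDual ⟨(OrderDual.ofDual p.1).1 ⊓ (OrderDual.ofDual q.1).1, fun y hy =>
      le_inf ((OrderDual.ofDual p.1).2 hy) ((OrderDual.ofDual q.1).2 hy)⟩, max p.2 q.2),
      ⟨inf_le_left (a := (OrderDual.ofDual p.1).1), le_max_left _ _⟩,
      ⟨inf_le_right (a := (OrderDual.ofDual p.1).1), le_max_right _ _⟩⟩⟩
  have ht := (hτ _ _).2 (orderConv_upperBounds_sub hArch hs ⟨_, hb⟩)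
  obtain ⟨⟨b, n⟩, hbn⟩ := (ht.eventually hu).exists
  refine hcu n ?_
  calc c n • f n = s (n + 1) - s n := by simp [hsdef, Finset.sum_range_succ]
    _ ≤ (OrderDual.ofDual b).1 - s n :=
      sub_le_sub_right ((OrderDual.ofDual b).2 ⟨n + 1, rfl⟩) _
    _ ≤ u := (le_abs_self _).trans hbn

end Topological

section FiniteDimensional

/-- In a finite dimensional Archimedean Riesz space with an order unit norm, order convergence is
norm convergence. -/
theorem tendsto_iff_orderConv_of_norm_le_iff {X : Type u} [Lattice X] [NormedAddCommGroup X]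
    [IsOrderedAddMonoid X] [NormedSpace ℝ X] [PosSMulMono ℝ X] [FiniteDimensional ℝ X]
    (hArch : ∀ x u : X, (∀ n : ℕ, n • x ≤ u) → x ≤ 0) {u : X}
    (hnorm : ∀ (x : X) (r : ℝ), 0 ≤ r → (‖x‖ ≤ r ↔ |x| ≤ r • u))
    {Λ : Type v} [Preorder Λ] [Nonempty Λ] [IsDirected Λ (· ≤ ·)] (x : Λ → X) (l : X) :
    Tendsto x atTop (𝓝 l) ↔ OrderConv x l := by
  have hu : 0 ≤ u := by simpa using (hnorm 0 1 zero_le_one).1 (by simp)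
  have hmono : ∀ {y z : X}, |y| ≤ z → ‖y‖ ≤ ‖z‖ := fun {y z} h =>
    (hnorm _ _ (norm_nonneg z)).2
      (h.trans ((le_abs_self z).trans ((hnorm z _ (norm_nonneg z)).1 le_rfl)))
  have hclosed : ∀ a : X, IsClosed (Set.Iic a) := fun a => by
    refine isClosed_of_closure_subset fun y hy => ?_
    refine sub_nonpos.1 (le_zero_of_forall_le_smul hArch hu fun ε hε => ?_)
    obtain ⟨z, hz, hyz⟩ := Metric.mem_closure_iff.1 hy ε hε
    rw [dist_eq_norm] at hyz
    exact (sub_le_sub_left hz y).trans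
      ((le_abs_self _).trans ((hnorm _ _ hε.le).1 hyz.le))
  have hclosed0 : IsClosed (Set.Ici (0 : X)) := by
    have : Set.Ici (0 : X) = Neg.neg ⁻¹' Set.Iic 0 := by ext; simp
    rw [this]
    exact (hclosed 0).preimage continuous_neg
  simp only [Metric.tendsto_nhds, eventually_atTop]
  constructor
  · intro h
    refine ⟨ULift.{u} ℕ, inferInstance, inferInstance, inferInstance, _,
      fun m n hmn => inv_smul_le_inv_smul hu hmn, isGLB_range_inv_smul hArch hu, fun n => ?_⟩
    obtain ⟨α₀, hα₀⟩ := h (n.down + 1 : ℝ)⁻¹ (by positivity)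
    refine ⟨α₀, fun α hα => (hnorm _ _ (by positivity)).1 ?_⟩
    rw [← dist_eq_norm]
    exact (hα₀ α hα).le
  · rintro ⟨Γ, _, _, _, d, hd, hglb, hx⟩ ε hε
    have := FiniteDimensional.proper_real X
    obtain ⟨γ₀⟩ := ‹Nonempty Γ›
    have hd0 : ∀ γ, 0 ≤ d γ := fun γ => hglb.1 ⟨γ, rfl⟩
    have hbdd : map d atTop ≤ 𝓟 (Metric.closedBall 0 ‖d γ₀‖) := by
      refine le_principal_iff.2 (mem_map.2 (mem_of_superset (mem_atTop γ₀) fun γ hγ => ?_))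
      rw [Set.mem_preimage, mem_closedBall_zero_iff]
      exact hmono ((abs_of_nonneg (hd0 γ)).trans_le (hd _ _ hγ))
    have : (atTop : Filter Γ).NeBot := atTop_neBot_iff.2 ⟨⟨γ₀⟩, ‹_›⟩
    obtain ⟨y, -, hy⟩ := (isCompact_closedBall (0 : X) _).exists_clusterPt hbdd
    have hy0 : y = 0 := by
      refine le_antisymm (hglb.2 ?_) ?_
      · rintro _ ⟨γ, rfl⟩
        have : Set.Iic (d γ) ∈ map d atTop :=
          mem_map.2 (mem_of_superset (mem_atTop γ) fun γ' hγ' => hd _ _ hγ')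
        exact (hclosed _).closure_subset (hy.mem_closure_of_mem _ this)
      · have : Set.Ici 0 ∈ map d atTop := mem_map.2 (univ_mem' hd0)
        exact hclosed0.closure_subset (hy.mem_closure_of_mem _ this)
    subst hy0
    obtain ⟨γ, hγ⟩ : ∃ γ, d γ ∈ Metric.ball 0 ε :=
      (frequently_map.1 (hy.frequently (Metric.ball_mem_nhds 0 hε))).exists
    obtain ⟨α₀, hα₀⟩ := hx γ
    refine ⟨α₀, fun α hα => ?_⟩
    rw [dist_eq_norm]
    exact (hmono (hα₀ α hα)).trans_lt (mem_ball_zero_iff.1 hγ)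

/-- The order unit seminorm with respect to `u`. -/
noncomputable def orderUnitNorm {X : Type*} [Lattice X] [AddCommGroup X] [Module ℝ X]
    (u x : X) : ℝ :=
  sInf {r : ℝ | 0 ≤ r ∧ |x| ≤ r • u}

variable {X : Type*} [Lattice X] [AddCommGroup X] [IsOrderedAddMonoid X] [Module ℝ X]
  [PosSMulMono ℝ X]

theorem orderUnitNorm_le_iff (hArch : ∀ x u : X, (∀ n : ℕ, n • x ≤ u) → x ≤ 0) {u : X}
    (hu : 0 ≤ u) (hunit : ∀ x : X, ∃ r : ℝ, 0 ≤ r ∧ |x| ≤ r • u) (x : X) {r : ℝ} (hr : 0 ≤ r) :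
    orderUnitNorm u x ≤ r ↔ |x| ≤ r • u := by
  have hbdd : BddBelow {r : ℝ | 0 ≤ r ∧ |x| ≤ r • u} := ⟨0, fun _ h => h.1⟩
  refine ⟨fun h => ?_, fun h => csInf_le hbdd ⟨hr, h⟩⟩
  refine sub_nonpos.1 (le_zero_of_forall_le_smul hArch hu fun ε hε => ?_)
  obtain ⟨c, hc, hlt⟩ := exists_lt_of_csInf_lt (hunit x)
    (lt_of_le_of_lt h (lt_add_of_pos_right r hε))
  rw [sub_le_iff_le_add, ← add_smul, add_comm]
  exact hc.2.trans (smul_le_smul_of_nonneg_right hlt.le hu)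

theorem normedSpaceCore_orderUnitNorm (hArch : ∀ x u : X, (∀ n : ℕ, n • x ≤ u) → x ≤ 0) {u : X}
    (hu : 0 ≤ u) (hunit : ∀ x : X, ∃ r : ℝ, 0 ≤ r ∧ |x| ≤ r • u) :
    let _ : Norm X := ⟨orderUnitNorm u⟩
    NormedSpace.Core ℝ X := by
  let _ : Norm X := ⟨orderUnitNorm u⟩
  have hle : ∀ (x : X) {r : ℝ}, 0 ≤ r → (‖x‖ ≤ r ↔ |x| ≤ r • u) := fun x _ hr =>
    orderUnitNorm_le_iff hArch hu hunit x hr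
  have h0 : ∀ x : X, 0 ≤ ‖x‖ := fun x => Real.sInf_nonneg fun _ h => h.1
  have habs : ∀ x : X, |x| ≤ ‖x‖ • u := fun x => (hle x (h0 x)).1 le_rfl
  have hsmul : ∀ (c : ℝ) (x : X), ‖c • x‖ ≤ ‖c‖ * ‖x‖ := fun c x => by
    rw [hle _ (mul_nonneg (norm_nonneg c) (h0 x)), mul_smul]
    exact (abs_smul_le_smul_abs c x).trans (smul_le_smul_of_nonneg_left (habs x) (abs_nonneg c))
  refine ⟨⟨h0, fun c x => (hsmul c x).antisymm ?_, fun x y => ?_⟩, fun x => ⟨fun h => ?_, ?_⟩⟩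
  · rcases eq_or_ne c 0 with rfl | hc
    · simpa using h0 _
    · have h := hsmul c⁻¹ (c • x)
      rw [inv_smul_smul₀ hc, norm_inv] at h
      rwa [← le_inv_mul_iff₀ (norm_pos_iff.2 hc)]
  · rw [hle _ (add_nonneg (h0 x) (h0 y)), add_smul]
    exact (abs_add_le x y).trans (add_le_add (habs x) (habs y))
  · have := habs x
    rw [h, zero_smul, abs_le'] at this
    exact le_antisymm this.1 (neg_nonpos.1 this.2)
  · rintro rfl
    refine le_antisymm ((hle 0 le_rfl).2 (by simp)) (h0 0)

theorem exists_orderUnit_of_finiteDimensional [FiniteDimensional ℝ X] :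
    ∃ u : X, 0 ≤ u ∧ ∀ x : X, ∃ r : ℝ, 0 ≤ r ∧ |x| ≤ r • u := by
  let b := Module.finBasis ℝ X
  refine ⟨∑ i, |b i|, Finset.sum_nonneg fun i _ => abs_nonneg _, fun x =>
    ⟨∑ i, |b.repr x i|, Finset.sum_nonneg fun i _ => abs_nonneg _, ?_⟩⟩
  have habs : ∀ s : Finset (Fin (Module.finrank ℝ X)),
      |∑ i ∈ s, b.repr x i • b i| ≤ ∑ i ∈ s, |b.repr x i| • |b i| := fun s =>
    Finset.le_sum_of_subadditive _ abs_zero.le abs_add_le s _ |>.trans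
      (Finset.sum_le_sum fun i _ => abs_smul_le_smul_abs _ _)
  calc |x| = |∑ i, b.repr x i • b i| := by rw [b.sum_repr]
    _ ≤ ∑ i, |b.repr x i| • |b i| := habs _
    _ ≤ ∑ i, |b.repr x i| • ∑ j, |b j| := Finset.sum_le_sum fun i _ =>
      smul_le_smul_of_nonneg_left
        (Finset.single_le_sum (f := fun j => |b j|) (fun j _ => abs_nonneg _) (Finset.mem_univ i))
        (abs_nonneg _)
    _ = (∑ i, |b.repr x i|) • ∑ j, |b j| := (Finset.sum_smul).symm

end FiniteDimensional

/-- Order convergence on an Archimedean Riesz space `X`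
over `ℝ` is topological (there is a topology whose convergence of nets
coincides with order convergence) iff `X` is finite dimensional. -/
theorem orderConvergence_topological_iff_finiteDimensional
    {X : Type u} [Lattice X] [AddCommGroup X]
    [CovariantClass X X (· + ·) (· ≤ ·)] [Module ℝ X] [PosSMulMono ℝ X]
    (hArch : ∀ x u : X, (∀ n : ℕ, n • x ≤ u) → x ≤ 0) :
    (∃ τ : TopologicalSpace X,
      ∀ (Λ : Type u) [Preorder Λ] [Nonempty Λ] [IsDirected Λ (· ≤ ·)]
        (x : Λ → X) (l : X),
        Filter.Tendsto x Filter.atTop (@nhds X τ l) ↔ OrderConv x l) ↔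
    FiniteDimensional ℝ X := by
  have : IsOrderedAddMonoid X :=
    { add_le_add_left := fun a b h c => by
        rw [add_comm a, add_comm b]
        exact CovariantClass.elim c h }
  constructor
  · rintro ⟨τ, hτ⟩
    exact finiteDimensional_of_orderConv_iff_tendsto hArch fun Λ _ _ _ x => hτ Λ x 0
  · intro hfin
    obtain ⟨u, hu, hunit⟩ := exists_orderUnit_of_finiteDimensional (X := X)
    let _ : Norm X := ⟨orderUnitNorm u⟩
    have core : NormedSpace.Core ℝ X := normedSpaceCore_orderUnitNorm hArch hu hunit
    let _ : NormedAddCommGroup X := NormedAddCommGroup.ofCore core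
    let _ : NormedSpace ℝ X := NormedSpace.ofCore core
    exact ⟨inferInstance, fun Λ _ _ _ x l => tendsto_iff_orderConv_of_norm_le_iff hArch
      (fun x r hr => orderUnitNorm_le_iff hArch hu hunit x hr) x l⟩
end

section
/- Let X be an Archimedean Riesz space over ℝ. There exists a topology τ on X such that, for every net (x_α) in X and every x ∈ X, x_α → x in τ if and only if x_α →u x (relative uniform convergence), if and only if X has a strong unit. -/
open Filter Set Topology

universe u v

/-- Relative uniform convergence of a net `x : A → X` to `l`: there is
`e ≥ 0` such that for every `ε > 0` eventually `|x α - l| ≤ ε • e`. -/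
def RUConv {X : Type u} {A : Type v} [Lattice X] [AddCommGroup X] [Module ℝ X]
    [Preorder A] (x : A → X) (l : X) : Prop :=
  ∃ e : X, 0 ≤ e ∧ ∀ ε : ℝ, 0 < ε →
    ∃ α₀ : A, ∀ α : A, α₀ ≤ α → |x α - l| ≤ ε • e

section OrderedModule

variable {X : Type u} [Lattice X] [AddCommGroup X] [IsOrderedAddMonoid X] [Module ℝ X]
  [PosSMulMono ℝ X]

lemma smul_le_smul_of_le_of_nonneg {a b : ℝ} (h : a ≤ b) {e : X} (he : 0 ≤ e) :
    a • e ≤ b • e := by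
  rw [← sub_nonneg, ← sub_smul]
  exact smul_nonneg (sub_nonneg.2 h) he

/-- The filter at `l` generated by the order intervals `{x | |x - l| ≤ ε • e}`, `ε > 0`. -/
def orderUnitNhds (e l : X) : Filter X :=
  ⨅ ε : {ε : ℝ // 0 < ε}, 𝓟 {x | |x - l| ≤ ε.1 • e}

lemma hasBasis_orderUnitNhds {e : X} (he : 0 ≤ e) (l : X) :
    (orderUnitNhds e l).HasBasis (fun ε : ℝ => 0 < ε) fun ε => {x | |x - l| ≤ ε • e} := by
  have : Nonempty {ε : ℝ // 0 < ε} := ⟨⟨1, one_pos⟩⟩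
  refine ⟨fun t => ?_⟩
  rw [orderUnitNhds, mem_iInf_of_directed]
  · simp
  · rintro ⟨a, ha⟩ ⟨b, hb⟩
    refine ⟨⟨min a b, lt_min ha hb⟩, ?_, ?_⟩ <;>
    · refine principal_mono.2 fun x hx => le_trans hx (smul_le_smul_of_le_of_nonneg ?_ he)
      simp

lemma nhds_mkOfNhds_orderUnitNhds {e : X} (he : 0 ≤ e) (l : X) :
    @nhds X (TopologicalSpace.mkOfNhds (orderUnitNhds e)) l = orderUnitNhds e l := by
  refine TopologicalSpace.nhds_mkOfNhds_of_hasBasis (hasBasis_orderUnitNhds he) ?_ ?_ l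
  · intro a ε hε
    simpa using smul_nonneg hε.le he
  · intro a ε hε
    refine (hasBasis_orderUnitNhds he a).mem_iff.2 ⟨ε / 2, half_pos hε, fun y hy => ?_⟩
    refine (hasBasis_orderUnitNhds he y).mem_iff.2 ⟨ε / 2, half_pos hε, fun z hz => ?_⟩
    calc |z - a| = |(z - y) + (y - a)| := by rw [sub_add_sub_cancel]
      _ ≤ |z - y| + |y - a| := abs_add_le _ _
      _ ≤ (ε / 2) • e + (ε / 2) • e := add_le_add hz hy
      _ = ε • e := by rw [← add_smul, add_halves]

lemma tendsto_orderUnitNhds_iff_ruConv {e : X} (he : 0 ≤ e)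
    (hunit : ∀ x : X, ∃ n : ℕ, |x| ≤ n • e) {A : Type v} [Preorder A] [Nonempty A]
    [IsDirected A (· ≤ ·)] (x : A → X) (l : X) :
    Tendsto x atTop (orderUnitNhds e l) ↔ RUConv x l := by
  simp only [(hasBasis_orderUnitNhds he l).tendsto_right_iff, eventually_atTop, Set.mem_ofPred_eq]
  refine ⟨fun h => ⟨e, he, h⟩, fun ⟨f, _, h⟩ ε hε => ?_⟩
  obtain ⟨n, hn⟩ := hunit f
  obtain ⟨a, ha⟩ := h (ε / (n + 1)) (by positivity)
  refine ⟨a, fun b hb => (ha b hb).trans ?_⟩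
  calc (ε / (n + 1)) • f ≤ (ε / (n + 1)) • ((n : ℝ) • e) := by
        refine smul_le_smul_of_nonneg_left ((le_abs_self f).trans ?_) (by positivity)
        rwa [Nat.cast_smul_eq_nsmul]
    _ = (ε / (n + 1) * n) • e := smul_smul _ _ _
    _ ≤ ε • e := by
        refine smul_le_smul_of_le_of_nonneg ?_ he
        rw [div_mul_eq_mul_div, div_le_iff₀ (by positivity)]
        nlinarith

lemma ruConv_inv_smul {f : X} (hf : 0 ≤ f) :
    RUConv (fun n : ULift.{v} ℕ => ((n.down : ℝ) + 1)⁻¹ • f) 0 := by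
  refine ⟨f, hf, fun ε hε => ?_⟩
  obtain ⟨n, hn⟩ := exists_nat_one_div_lt hε
  refine ⟨⟨n⟩, fun m hm => ?_⟩
  have hm' : (n : ℝ) ≤ m.down := Nat.cast_le.2 hm
  rw [sub_zero, abs_of_nonneg (smul_nonneg (by positivity) hf)]
  refine smul_le_smul_of_le_of_nonneg (le_trans ?_ hn.le) hf
  rw [one_div]
  gcongr

end OrderedModule

/-- Pairs of a member of a filter and a point of that member. -/
def PointedMem {X : Type u} (F : Filter X) : Type u :=
  {p : Set X × X // p.1 ∈ F ∧ p.2 ∈ p.1}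

namespace PointedMem

variable {X : Type u} {F : Filter X}

/-- Pointed members of a filter are ordered by reverse inclusion of the members. -/
instance : Preorder (PointedMem F) :=
  Preorder.lift fun p => OrderDual.toDual p.1.1

lemma le_iff {p q : PointedMem F} : p ≤ q ↔ q.1.1 ⊆ p.1.1 := Iff.rfl

instance [F.NeBot] : Nonempty (PointedMem F) :=
  let ⟨x⟩ := F.nonempty_of_neBot
  ⟨⟨(univ, x), univ_mem, mem_univ x⟩⟩

instance [F.NeBot] : IsDirected (PointedMem F) (· ≤ ·) where
  directed p q := by
    have h := inter_mem p.2.1 q.2.1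
    obtain ⟨x, hx⟩ := F.nonempty_of_mem h
    exact ⟨⟨(p.1.1 ∩ q.1.1, x), h, hx⟩, inter_subset_left, inter_subset_right⟩

lemma tendsto_point [F.NeBot] : Tendsto (fun p : PointedMem F => p.1.2) atTop F := by
  intro s hs
  obtain ⟨x, hx⟩ := F.nonempty_of_mem hs
  exact mem_atTop_sets.2 ⟨⟨(s, x), hs, hx⟩, fun q hq => hq q.2.2⟩

end PointedMem

/-- Relative uniform convergence on an Archimedean Riesz
space `X` over `ℝ` is topological (there is a topology whose convergence of
nets coincides with relative uniform convergence) iff `X` has a strong unit. -/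
theorem relUnifConvergence_topological_iff_strong_unit
    {X : Type u} [Lattice X] [AddCommGroup X]
    [CovariantClass X X (· + ·) (· ≤ ·)] [Module ℝ X] [PosSMulMono ℝ X]
    (hArch : ∀ x u : X, (∀ n : ℕ, n • x ≤ u) → x ≤ 0) :
    (∃ τ : TopologicalSpace X,
      ∀ (Λ : Type u) [Preorder Λ] [Nonempty Λ] [IsDirected Λ (· ≤ ·)]
        (x : Λ → X) (l : X),
        Filter.Tendsto x Filter.atTop (@nhds X τ l) ↔ RUConv x l) ↔
    (∃ e : X, 0 ≤ e ∧ ∀ x : X, ∃ n : ℕ, |x| ≤ n • e) := by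
  have : IsOrderedAddMonoid X := { add_le_add_left := fun a b h c => by gcongr }
  constructor
  · rintro ⟨τ, hτ⟩
    obtain ⟨e, he, h⟩ := (hτ (PointedMem (𝓝 (0 : X))) _ 0).1 PointedMem.tendsto_point
    obtain ⟨p, hp⟩ := h 1 one_pos
    refine ⟨e, he, fun x => ?_⟩
    have hx := (hτ (ULift ℕ) _ 0).2 (ruConv_inv_smul (abs_nonneg x))
    obtain ⟨n, hn⟩ := (hx.eventually p.2.1).exists
    have hle := (le_abs_self _).trans
      (hp ⟨(p.1.1, ((n.down : ℝ) + 1)⁻¹ • |x|), p.2.1, hn⟩ (PointedMem.le_iff.2 subset_rfl))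
    rw [sub_zero, one_smul] at hle
    have hpos : (0 : ℝ) < n.down + 1 := by positivity
    refine ⟨n.down + 1, ?_⟩
    calc |x| = ((n.down : ℝ) + 1) • ((n.down : ℝ) + 1)⁻¹ • |x| :=
          (smul_inv_smul₀ hpos.ne' _).symm
      _ ≤ ((n.down : ℝ) + 1) • e := smul_le_smul_of_nonneg_left hle hpos.le
      _ = (n.down + 1) • e := by
          rw [← Nat.cast_smul_eq_nsmul ℝ, Nat.cast_add_one]
  · rintro ⟨e, he, hunit⟩
    refine ⟨TopologicalSpace.mkOfNhds (orderUnitNhds e), fun Λ _ _ _ x l => ?_⟩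
    rw [nhds_mkOfNhds_orderUnitNhds he]
    exact tendsto_orderUnitNhds_iff_ruConv he hunit x l
end

section
/- Consider the Riesz space C([0,1], ℝ) of continuous real-valued functions on [0,1] with the pointwise order. Let U, V ⊆ C([0,1], ℝ) be sets whose complements are order closed, and suppose the constant function 0 belongs to U and the constant function 1 belongs to V. Then U ∩ V is nonempty. (Consequently, the order topology on C([0,1], ℝ) — the topology whose closed sets are exactly the order closed sets — is not Hausdorff, and in particular is not a linear topology.) -/
open Filter Set Topology

universe u v

/-- A subset `A` of a vector lattice is order closed if whenever a net
contained in `A` order converges to some `y`, then `y ∈ A`. -/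
def OrderClosed' {X : Type u} [Lattice X] [AddCommGroup X] (A : Set X) : Prop :=
  ∀ (Λ : Type u) [Preorder Λ] [Nonempty Λ] [IsDirected Λ (· ≤ ·)]
    (x : Λ → X), (∀ α : Λ, x α ∈ A) → ∀ y : X, OrderConv x y → y ∈ A

theorem exists_mem_of_orderClosed_compl {X : Type} [Lattice X] [AddCommGroup X] {U : Set X}
    (hU : OrderClosed' Uᶜ) {l : X} (hl : l ∈ U) {x d : ℕ → X} (hd : Antitone d)
    (hd0 : IsGLB (Set.range d) 0) (hx : ∀ n, |x n - l| ≤ d n) : ∃ n, x n ∈ U := by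
  by_contra! h
  refine hU ℕ x h l ⟨ℕ, inferInstance, inferInstance, inferInstance, d, ?_, hd0, ?_⟩ hl
  · exact fun _ _ hmn => hd hmn
  · exact fun n => ⟨n, fun m hm => (hx m).trans (hd hm)⟩

/-- The tent function of height `1` centered at `q` with slope `k`. -/
noncomputable def tent {X : Type} [MetricSpace X] (q : X) (k : ℕ) : C(X, ℝ) where
  toFun t := max 0 (1 - k * dist t q)
  continuous_toFun := by fun_prop

section Tent

variable {X : Type} [MetricSpace X]

theorem tent_apply (q : X) (k : ℕ) (t : X) : tent q k t = max 0 (1 - k * dist t q) := rfl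

theorem tent_self (q : X) (k : ℕ) : tent q k q = 1 := by simp [tent_apply]

theorem tent_nonneg (q : X) (k : ℕ) : 0 ≤ tent q k := fun _ => le_max_left _ _

theorem tent_le_one (q : X) (k : ℕ) : tent q k ≤ 1 := fun t => by
  have : 0 ≤ k * dist t q := by positivity
  simpa [tent_apply] using this

theorem tent_antitone (q : X) : Antitone (tent q) := fun m n hmn t => by
  change max 0 (1 - n * dist t q) ≤ max 0 (1 - m * dist t q)
  gcongr

theorem ContinuousMap.nonpos_of_dense {b : C(X, ℝ)} {s : Set X} (hs : Dense s)
    (hb : ∀ t ∈ s, b t ≤ 0) : b ≤ 0 := fun t => by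
  have hc : IsClosed {t | b t ≤ 0} := isClosed_le b.continuous continuous_const
  exact closure_minimal hb hc (hs t)

theorem isGLB_range_tent (q : X) [(𝓝[≠] q).NeBot] : IsGLB (Set.range (tent q)) 0 := by
  refine ⟨?_, fun b hb => ContinuousMap.nonpos_of_dense (dense_compl_singleton q) fun t ht => ?_⟩
  · rintro _ ⟨k, rfl⟩
    exact tent_nonneg q k
  · have hpos : 0 < dist t q := dist_pos.2 ht
    obtain ⟨k, hk⟩ := exists_nat_gt (1 / dist t q)
    rw [div_lt_iff₀ hpos] at hk
    refine (hb ⟨k, rfl⟩ t).trans ?_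
    exact max_le le_rfl (by linarith)

theorem exists_mem_ge_apply_eq_one {U : Set C(X, ℝ)} (hU : OrderClosed' Uᶜ) (q : X)
    [(𝓝[≠] q).NeBot] {g : C(X, ℝ)} (hg : g ∈ U) (hg0 : 0 ≤ g) (hg1 : g ≤ 1) :
    ∃ g' ∈ U, g ≤ g' ∧ g' ≤ 1 ∧ g' q = 1 := by
  obtain ⟨k, hk⟩ := exists_mem_of_orderClosed_compl hU hg (x := fun k => g ⊔ tent q k)
    (tent_antitone q) (isGLB_range_tent q) fun k t => by
      have h1 : 0 ≤ g t := hg0 t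
      have h2 : 0 ≤ tent q k t := tent_nonneg q k t
      rw [abs_of_nonneg (sub_nonneg.2 le_sup_left)]
      change g t ⊔ tent q k t - g t ≤ tent q k t
      exact sub_le_iff_le_add.2 (sup_le (by linarith) (by linarith))
  refine ⟨_, hk, le_sup_left, sup_le hg1 (tent_le_one q k), ?_⟩
  rw [ContinuousMap.sup_apply, tent_self]
  exact sup_of_le_right (hg1 q)

theorem inter_nonempty_of_orderClosed_compl [TopologicalSpace.SeparableSpace X] [Nonempty X]
    [∀ q : X, (𝓝[≠] q).NeBot] {U V : Set C(X, ℝ)} (hU : OrderClosed' Uᶜ) (hV : OrderClosed' Vᶜ)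
    (h0 : 0 ∈ U) (h1 : 1 ∈ V) : (U ∩ V).Nonempty := by
  let q := TopologicalSpace.denseSeq X
  have step (n : ℕ) (g : {g : C(X, ℝ) // g ∈ U ∧ 0 ≤ g ∧ g ≤ 1}) :
      ∃ g' : {g : C(X, ℝ) // g ∈ U ∧ 0 ≤ g ∧ g ≤ 1}, g ≤ g' ∧ g'.1 (q n) = 1 := by
    obtain ⟨g', hg', hle, hle1, hq⟩ := exists_mem_ge_apply_eq_one hU (q n) g.2.1 g.2.2.1 g.2.2.2
    exact ⟨⟨g', hg', g.2.2.1.trans hle, hle1⟩, hle, hq⟩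
  choose next hnext_le hnext_q using step
  let g : ℕ → {g : C(X, ℝ) // g ∈ U ∧ 0 ≤ g ∧ g ≤ 1} :=
    fun n => Nat.rec ⟨0, h0, le_rfl, fun _ => zero_le_one⟩ next n
  have hg_mono : Monotone g := monotone_nat_of_le_succ fun n => hnext_le n (g n)
  obtain ⟨n, hn⟩ := exists_mem_of_orderClosed_compl hV h1 (x := fun n => (g n).1)
    (d := fun n => 1 - (g n).1) (fun _ _ hmn => sub_le_sub_left (Subtype.coe_le_coe.2 (hg_mono hmn)) 1)
    ⟨by
      rintro _ ⟨n, rfl⟩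
      exact sub_nonneg.2 (g n).2.2.2, fun b hb =>
      ContinuousMap.nonpos_of_dense (TopologicalSpace.denseRange_denseSeq X) <| by
        rintro _ ⟨n, rfl⟩
        refine (hb ⟨n + 1, rfl⟩ (q n)).trans_eq ?_
        exact sub_eq_zero.2 (hnext_q n (g n)).symm⟩
    fun n => by rw [abs_sub_comm, abs_of_nonneg (sub_nonneg.2 (g n).2.2.2)]
  exact ⟨_, (g n).2.1, hn⟩

end Tent

/-- In the Riesz space `C([0,1], ℝ)` with the pointwise
order, any two sets `U`, `V` whose complements are order closed and which
contain the constant functions `0` and `1` respectively must intersect.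
(Hence the order topology on `C([0,1], ℝ)` is not Hausdorff, in particular
not a linear topology.) -/
theorem orderTopology_C01_not_Hausdorff
    (U V : Set (ContinuousMap (Set.Icc (0 : ℝ) 1) ℝ))
    (hU : OrderClosed' Uᶜ) (hV : OrderClosed' Vᶜ)
    (h0 : (0 : ContinuousMap (Set.Icc (0 : ℝ) 1) ℝ) ∈ U)
    (h1 : (1 : ContinuousMap (Set.Icc (0 : ℝ) 1) ℝ) ∈ V) :
    (U ∩ V).Nonempty := by
  exact inter_nonempty_of_orderClosed_compl hU hV h0 h1
end
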